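/- Let f be a C^3 Lorenz map with negative Schwarzian derivative and no periodic attractors, and let C be a nice interval of f with transfer map T defined on U = ∪_{n≥0} f^{−n}(C). Then the complement [0,1]∖U of the domain of the transfer map has zero Lebesgue measure; equivalently, Lebesgue-almost every point of [0,1] eventually enters C under iteration of f. -/

import Mathlib

open Set

/-- The Lorenz map `f = (u,v,c,φ,ψ)` with critical exponent `ρ`:
`f(x) = φ(u(1-((c-x)/c)^ρ))` for `x < c` and `f(x) = ψ(1+v(-1+((x-c)/(1-c))^ρ))`
for `x ≥ c` (by convention, at the critical point `c` we take the right branch). -/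
noncomputable def lorenzF (ρ u v c : ℝ) (φ ψ : ℝ → ℝ) : ℝ → ℝ := fun x =>
  if x < c then φ (u * (1 - ((c - x) / c) ^ ρ))
  else ψ (1 + v * (-1 + ((x - c) / (1 - c)) ^ ρ))

/-- The data `(u,v,c,φ,ψ)` of a Cᵏ Lorenz map with critical exponent `ρ > 1`:
`u,v ∈ (0,1]`, `c ∈ (0,1)`, and `φ, ψ` are Cᵏ orientation-preserving
diffeomorphisms of `[0,1]` fixing `0` and `1`. -/
structure IsLorenz (k : ℕ) (ρ u v c : ℝ) (φ ψ : ℝ → ℝ) : Prop where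
  one_lt_rho : 1 < ρ
  u_pos : 0 < u
  u_le_one : u ≤ 1
  v_pos : 0 < v
  v_le_one : v ≤ 1
  c_pos : 0 < c
  c_lt_one : c < 1
  phi_smooth : ContDiffOn ℝ k φ (Icc 0 1)
  psi_smooth : ContDiffOn ℝ k ψ (Icc 0 1)
  phi_zero : φ 0 = 0
  phi_one : φ 1 = 1
  psi_zero : ψ 0 = 0
  psi_one : ψ 1 = 1
  phi_deriv_pos : ∀ x ∈ Icc (0:ℝ) 1, 0 < derivWithin φ (Icc 0 1) x
  psi_deriv_pos : ∀ x ∈ Icc (0:ℝ) 1, 0 < derivWithin ψ (Icc 0 1) x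

/-- `dist[φ] ≤ π`: the distortion bound `log (Dφ(y)/Dφ(x)) ≤ π` for all `x,y ∈ [0,1]`. -/
def DistBound (φ : ℝ → ℝ) (π : ℝ) : Prop :=
  ∀ x ∈ Icc (0:ℝ) 1, ∀ y ∈ Icc (0:ℝ) 1,
    Real.log (derivWithin φ (Icc 0 1) y / derivWithin φ (Icc 0 1) x) ≤ π

/-- `f` is C³ on `[0,1]∖{c}` with negative Schwarzian derivative
`S_f = f'''/f' - (3/2)(f''/f')² < 0` there. -/
def NegSchwarzian (f : ℝ → ℝ) (c : ℝ) : Prop :=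
  ContDiffOn ℝ 3 f (Icc 0 1 \ {c}) ∧
  ∀ x ∈ Icc (0:ℝ) 1 \ {c},
    derivWithin (derivWithin (derivWithin f (Icc 0 1 \ {c})) (Icc 0 1 \ {c}))
          (Icc 0 1 \ {c}) x / derivWithin f (Icc 0 1 \ {c}) x -
        3 / 2 * (derivWithin (derivWithin f (Icc 0 1 \ {c})) (Icc 0 1 \ {c}) x /
          derivWithin f (Icc 0 1 \ {c}) x) ^ 2 < 0

/-- `f` has no periodic attractors: no periodic orbit whose basin of attraction
contains a nonempty open set. -/
def NoPeriodicAttractor (f : ℝ → ℝ) : Prop :=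
  ∀ x ∈ Icc (0:ℝ) 1, ∀ k : ℕ, 1 ≤ k → f^[k] x = x →
    ¬∃ s : Set ℝ, IsOpen s ∧ s.Nonempty ∧ s ⊆ Icc 0 1 ∧
      ∀ y ∈ s, Filter.Tendsto
        (fun j => Metric.infDist (f^[j] y) (Set.range fun i : ℕ => f^[i] x))
        Filter.atTop (nhds 0)

/-- `Γ = [0,1] ∖ dom T`, the complement of the domain
`U = ∪_{n ≥ 0} f⁻ⁿ(C)` of the transfer map to the nice interval `C = (a,b)`:
the set of points of `[0,1]` whose orbit never enters `C`. -/
def avoidSet (f : ℝ → ℝ) (a b : ℝ) : Set ℝ :=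
  {x | x ∈ Icc (0:ℝ) 1 ∧ ∀ n : ℕ, f^[n] x ∉ Ioo a b}

/-- The cross-ratio `|L| |R| / (|T| |J|)` of `T = [p, s]`, `J = [q, r]`, where `L` and `R` are the
components of `T ∖ J`. -/
noncomputable def crossRatio (p q r s : ℝ) : ℝ := (q - p) * (s - r) / ((s - p) * (r - q))

/-- The properties of a Lorenz map with negative Schwarzian derivative that enter the dynamical
part of the argument. -/
structure LorenzLike (f : ℝ → ℝ) (c : ℝ) : Prop where
  c_mem : c ∈ Ioo (0:ℝ) 1
  mapsTo : MapsTo f (Icc 0 1) (Icc 0 1)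
  map_one : f 1 = 1
  mono_left : StrictMonoOn f (Ico 0 c)
  mono_right : StrictMonoOn f (Ioc c 1)
  cont : ContinuousOn f (Icc 0 1 \ {c})
  crossRatio_lt : ∀ p q r s, 0 < p → p < q → q < r → r < s → s < 1 → (s < c ∨ c < p) →
    crossRatio (f p) (f q) (f r) (f s) < crossRatio p q r s
  distortion : ∀ e, 0 < e → ∃ B, 0 ≤ B ∧ ∀ s t w, 0 ≤ s → s < t → t ≤ w → w ≤ 1 →
    (w ≤ c - e ∨ c + e ≤ s) →
    (f w - f t) * (t - s) ≤ Real.exp (B * (w - s)) * ((f t - f s) * (w - t))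

/-- The first `n` iterates of `[s, t]` do not contain `c`. -/
def NoCrit (f : ℝ → ℝ) (c : ℝ) (n : ℕ) (s t : ℝ) : Prop :=
  ∀ i < n, ∀ z ∈ Icc s t, f^[i] z ≠ c

/-- The points of `[0, 1]` that are not separated from `x` by a preimage of `c`. -/
def homterval (f : ℝ → ℝ) (c x : ℝ) : Set ℝ :=
  {y | y ∈ Icc (0:ℝ) 1 ∧ ∀ z ∈ uIcc x y, ∀ n, f^[n] z ≠ c}

namespace LorenzLike

variable {f : ℝ → ℝ} {c : ℝ}

lemma iterate_mem (h : LorenzLike f c) {x : ℝ} (hx : x ∈ Icc (0:ℝ) 1) (n : ℕ) :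
    f^[n] x ∈ Icc (0:ℝ) 1 := h.mapsTo.iterate n hx

lemma mapsTo_Ioo (h : LorenzLike f c) {x : ℝ} (hx : x ∈ Ioo (0:ℝ) 1) (hxc : x ≠ c) :
    f x ∈ Ioo (0:ℝ) 1 := by
  obtain ⟨hc0, hc1⟩ := h.c_mem
  obtain ⟨h0, h1⟩ := hx
  rcases lt_or_gt_of_ne hxc with hlt | hgt
  · have hA := h.mono_left (show (0:ℝ) ∈ Ico 0 c from ⟨le_rfl, hc0⟩) ⟨h0.le, hlt⟩ h0
    have hB := h.mono_left (show x ∈ Ico 0 c from ⟨h0.le, hlt⟩)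
      (show (x + c) / 2 ∈ Ico 0 c from ⟨by linarith, by linarith⟩) (by linarith)
    have hC := (h.mapsTo (show (0:ℝ) ∈ Icc 0 1 by simp)).1
    have hD := (h.mapsTo (show (x + c) / 2 ∈ Icc (0:ℝ) 1 from ⟨by linarith, by linarith⟩)).2
    exact ⟨by linarith, by linarith⟩
  · have hA := h.mono_right (show x ∈ Ioc c 1 from ⟨hgt, h1.le⟩) ⟨hc1, le_rfl⟩ h1
    have hB := h.mono_right (show (x + c) / 2 ∈ Ioc c 1 from ⟨by linarith, by linarith⟩)
      (show x ∈ Ioc c 1 from ⟨hgt, h1.le⟩) (by linarith)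
    have hC := (h.mapsTo (show (x + c) / 2 ∈ Icc (0:ℝ) 1 from ⟨by linarith, by linarith⟩)).1
    have hD := h.map_one
    exact ⟨by linarith, by linarith⟩

lemma iterate_cont_mono (h : LorenzLike f c) {s t : ℝ} (hs : 0 ≤ s) (ht : t ≤ 1) (n : ℕ)
    (hn : NoCrit f c n s t) :
    ContinuousOn f^[n] (Icc s t) ∧ StrictMonoOn f^[n] (Icc s t) := by
  have hsub : ∀ z ∈ Icc s t, z ∈ Icc (0:ℝ) 1 := fun z hz => ⟨hs.trans hz.1, hz.2.trans ht⟩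
  induction n with
  | zero => exact ⟨continuousOn_id, strictMono_id.strictMonoOn _⟩
  | succ n ih =>
    obtain ⟨hc, hm⟩ := ih fun i hi => hn i (hi.trans n.lt_succ_self)
    rw [Function.iterate_succ']
    refine ⟨h.cont.comp hc fun z hz => ⟨h.iterate_mem (hsub z hz) n, hn n n.lt_succ_self z hz⟩, ?_⟩
    intro x hx y hy hxy
    have hlt := hm hx hy hxy
    have hxm := h.iterate_mem (hsub x hx) n
    have hym := h.iterate_mem (hsub y hy) n
    rcases lt_or_gt_of_ne (hn n n.lt_succ_self y hy) with hyc | hyc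
    · exact h.mono_left ⟨hxm.1, hlt.trans hyc⟩ ⟨hym.1, hyc⟩ hlt
    · have hxc : c < f^[n] x := by
        by_contra hcon
        obtain ⟨z, hz, hzc⟩ := intermediate_value_Icc hxy.le
          (hc.mono (Icc_subset_Icc hx.1 hy.2)) ⟨not_lt.1 hcon, hyc.le⟩
        exact hn n n.lt_succ_self z (Icc_subset_Icc hx.1 hy.2 hz) hzc
      exact h.mono_right ⟨hxc, hxm.2⟩ ⟨hyc, hym.2⟩ hlt

lemma image_Icc (h : LorenzLike f c) {s t : ℝ} (hs : 0 ≤ s) (ht : t ≤ 1) (hst : s ≤ t) (n : ℕ)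
    (hn : NoCrit f c n s t) {y : ℝ} (hy : y ∈ Icc (f^[n] s) (f^[n] t)) :
    ∃ z ∈ Icc s t, f^[n] z = y :=
  intermediate_value_Icc hst (h.iterate_cont_mono hs ht n hn).1 hy

lemma same_side (h : LorenzLike f c) {s t : ℝ} (hs : 0 ≤ s) (ht : t ≤ 1) (hst : s ≤ t) (n : ℕ)
    (hn : NoCrit f c (n + 1) s t) : f^[n] t < c ∨ c < f^[n] s := by
  by_contra! hcon
  obtain ⟨z, hz, hzc⟩ := h.image_Icc hs ht hst n (fun i hi => hn i (hi.trans n.lt_succ_self))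
    ⟨hcon.2, hcon.1⟩
  exact hn n n.lt_succ_self z hz hzc

lemma iterate_mem_Ioo (h : LorenzLike f c) {x : ℝ} (hx : x ∈ Ioo (0:ℝ) 1) (n : ℕ)
    (hn : ∀ i < n, f^[i] x ≠ c) : f^[n] x ∈ Ioo (0:ℝ) 1 := by
  induction n with
  | zero => exact hx
  | succ n ih =>
    rw [Function.iterate_succ_apply']
    exact h.mapsTo_Ioo (ih fun i hi => hn i (hi.trans n.lt_succ_self)) (hn n n.lt_succ_self)

lemma crossRatio_iterate_succ_lt (h : LorenzLike f c) {p q r s : ℝ} (hp : 0 < p) (hpq : p < q)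
    (hqr : q < r) (hrs : r < s) (hs : s < 1) (n : ℕ) (hn : NoCrit f c (n + 1) p s) :
    crossRatio (f^[n + 1] p) (f^[n + 1] q) (f^[n + 1] r) (f^[n + 1] s) < crossRatio p q r s := by
  have step : ∀ m, NoCrit f c (m + 1) p s →
      crossRatio (f^[m + 1] p) (f^[m + 1] q) (f^[m + 1] r) (f^[m + 1] s) <
        crossRatio (f^[m] p) (f^[m] q) (f^[m] r) (f^[m] s) := by
    intro m hm
    have hm' : NoCrit f c m p s := fun i hi => hm i (hi.trans m.lt_succ_self)
    have hmono := (h.iterate_cont_mono hp.le hs.le m hm').2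
    have mp : p ∈ Icc p s := ⟨le_rfl, by linarith⟩
    have mq : q ∈ Icc p s := ⟨by linarith, by linarith⟩
    have mr : r ∈ Icc p s := ⟨by linarith, by linarith⟩
    have ms : s ∈ Icc p s := ⟨by linarith, le_rfl⟩
    simp only [Function.iterate_succ_apply']
    exact h.crossRatio_lt _ _ _ _
      (h.iterate_mem_Ioo ⟨hp, by linarith⟩ m fun i hi => hm' i hi p mp).1
      (hmono mp mq hpq) (hmono mq mr hqr) (hmono mr ms hrs)
      (h.iterate_mem_Ioo ⟨by linarith, hs⟩ m fun i hi => hm' i hi s ms).2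
      (h.same_side hp.le hs.le (by linarith) m hm)
  induction n with
  | zero => exact step 0 hn
  | succ n ih => exact (step _ hn).trans (ih fun i hi => hn i (hi.trans (n + 1).lt_succ_self))

lemma crossRatio_iterate_le (h : LorenzLike f c) {p q r s : ℝ} (hp : 0 < p) (hpq : p < q)
    (hqr : q < r) (hrs : r < s) (hs : s < 1) (n : ℕ) (hn : NoCrit f c n p s) :
    crossRatio (f^[n] p) (f^[n] q) (f^[n] r) (f^[n] s) ≤ crossRatio p q r s := by
  cases n with
  | zero => exact le_rfl
  | succ n => exact (h.crossRatio_iterate_succ_lt hp hpq hqr hrs hs n hn).le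

/-- No iterate is the identity on a nondegenerate interval. -/
lemma not_iterate_eq_id (h : LorenzLike f c) {s t : ℝ} (hs : 0 ≤ s) (ht : t ≤ 1) (hst : s < t)
    {n : ℕ} (hn : NoCrit f c (n + 1) s t) : ¬ ∀ z ∈ Icc s t, f^[n + 1] z = z := by
  intro hid
  set d := (t - s) / 5 with hd
  have hdp : 0 < d := by positivity
  have hmem : ∀ k : ℝ, 0 ≤ k → k ≤ 5 → s + k * d ∈ Icc s t := fun k h0 h5 => by
    constructor
    · nlinarith
    · have : 5 * d = t - s := by rw [hd]; ring
      nlinarith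
  have key := h.crossRatio_iterate_succ_lt (p := s + 1 * d) (q := s + 2 * d) (r := s + 3 * d)
    (s := s + 4 * d) (by linarith) (by linarith) (by linarith) (by linarith) (by linarith) n
    (fun i hi z hz => hn i hi z ⟨by linarith [hz.1], by linarith [hz.2]⟩)
  rw [hid _ (hmem 1 (by norm_num) (by norm_num)), hid _ (hmem 2 (by norm_num) (by norm_num)),
    hid _ (hmem 3 (by norm_num) (by norm_num)), hid _ (hmem 4 (by norm_num) (by norm_num))] at key
  exact lt_irrefl _ key

/-! ### Homtervals -/

lemma homterval_self {x : ℝ} (hx : x ∈ Icc (0:ℝ) 1) (hxc : ∀ n, f^[n] x ≠ c) :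
    x ∈ homterval f c x :=
  ⟨hx, fun z hz => by
    rw [uIcc_self, mem_singleton_iff] at hz
    exact hz ▸ hxc⟩

lemma homterval_ordConnected (x : ℝ) : (homterval f c x).OrdConnected := by
  refine ordConnected_iff.2 fun y hy z hz hyz w hw => ⟨⟨hy.1.1.trans hw.1, hw.2.trans hz.1.2⟩, ?_⟩
  intro v hv
  rcases le_total x w with hxw | hxw
  · exact hz.2 v (uIcc_subset_uIcc left_mem_uIcc
      (by rw [uIcc_of_le (hxw.trans hw.2)]; exact ⟨hxw, hw.2⟩) hv)
  · exact hy.2 v (uIcc_subset_uIcc left_mem_uIcc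
      (by rw [uIcc_of_ge (hw.1.trans hxw)]; exact ⟨hw.1, hxw⟩) hv)

lemma homterval_trans {x y z : ℝ} (hy : y ∈ homterval f c x) (hz : z ∈ homterval f c y) :
    z ∈ homterval f c x :=
  ⟨hz.1, fun v hv => (uIcc_subset_uIcc_union_uIcc (b := y) hv).elim (hy.2 v) (hz.2 v)⟩

lemma homterval_symm {x y : ℝ} (hx : x ∈ Icc (0:ℝ) 1) (hy : y ∈ homterval f c x) :
    x ∈ homterval f c y :=
  ⟨hx, fun v hv => hy.2 v (by rwa [uIcc_comm])⟩

lemma mem_homterval_iff_of_le {x y : ℝ} (hxy : x ≤ y) (hy : y ∈ Icc (0:ℝ) 1) :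
    y ∈ homterval f c x ↔ ∀ n, NoCrit f c n x y := by
  constructor
  · intro h n i _ z hz
    exact h.2 z (by rwa [uIcc_of_le hxy]) i
  · intro h
    refine ⟨hy, fun z hz n => h (n + 1) n n.lt_succ_self z (by rwa [uIcc_of_le hxy] at hz)⟩

lemma homterval_noCrit {x s t : ℝ} (hx : x ∈ Icc (0:ℝ) 1) (hs : s ∈ homterval f c x)
    (ht : t ∈ homterval f c x) (hst : s ≤ t) (n : ℕ) : NoCrit f c n s t :=
  (mem_homterval_iff_of_le hst ht.1).1 (homterval_trans (homterval_symm hx hs) ht) n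

lemma map_homterval (h : LorenzLike f c) {x y : ℝ} (hx : x ∈ Icc (0:ℝ) 1)
    (hy : y ∈ homterval f c x) : f y ∈ homterval f c (f x) := by
  have key : ∀ s ∈ Icc (0:ℝ) 1, ∀ t ∈ Icc (0:ℝ) 1, s ≤ t → (∀ n, NoCrit f c n s t) →
      f s ≤ f t ∧ ∀ n, NoCrit f c n (f s) (f t) := by
    intro s hs t ht hst hn
    refine ⟨(h.iterate_cont_mono hs.1 ht.2 1 (hn 1)).2.monotoneOn ⟨le_rfl, hst⟩ ⟨hst, le_rfl⟩ hst,
      fun n i _ z hz => ?_⟩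
    obtain ⟨w, hw, rfl⟩ := h.image_Icc hs.1 ht.2 hst 1 (hn 1) hz
    exact hn (i + 2) (i + 1) (by omega) w hw
  rcases le_total x y with hxy | hxy
  · obtain ⟨h1, h2⟩ := key x hx y hy.1 hxy ((mem_homterval_iff_of_le hxy hy.1).1 hy)
    exact (mem_homterval_iff_of_le h1 (h.mapsTo hy.1)).2 h2
  · obtain ⟨h1, h2⟩ := key y hy.1 x hx hxy
      ((mem_homterval_iff_of_le hxy hx).1 (homterval_symm hx hy))
    exact homterval_symm (h.mapsTo hy.1) ((mem_homterval_iff_of_le h1 (h.mapsTo hx)).2 h2)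

lemma iterate_homterval (h : LorenzLike f c) {x y : ℝ} (hx : x ∈ Icc (0:ℝ) 1)
    (hy : y ∈ homterval f c x) (n : ℕ) : f^[n] y ∈ homterval f c (f^[n] x) := by
  induction n with
  | zero => exact hy
  | succ n ih =>
    simp only [Function.iterate_succ_apply']
    exact h.map_homterval (h.iterate_mem hx n) ih

lemma continuousWithinAt (h : LorenzLike f c) {y : ℝ} (hy : y ∈ Icc (0:ℝ) 1) (hyc : y ≠ c) :
    ContinuousWithinAt f (Icc 0 1) y :=
  (h.cont y ⟨hy, hyc⟩).mono_of_mem_nhdsWithin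
    (Filter.inter_mem self_mem_nhdsWithin (mem_nhdsWithin_of_mem_nhds (isOpen_ne.mem_nhds hyc)))

/-- If an orbit staying away from `c` returns to its own homterval, it is periodic. -/
lemma iterate_eq_of_mem_homterval (h : LorenzLike f c) (hNPA : NoPeriodicAttractor f) {z e : ℝ}
    {k : ℕ} (hz : z ∈ Icc (0:ℝ) 1) (hk : 1 ≤ k) (he : 0 < e)
    (hav : ∀ n, f^[n] z ∉ Ioo (c - e) (c + e)) (hrec : f^[k] z ∈ homterval f c z) :
    f^[k] z = z := by
  by_contra hne
  have hmul : ∀ m y, f^[k * (m + 1)] y = f^[k * m] (f^[k] y) := fun m y => by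
    rw [mul_add, mul_one, Function.iterate_add_apply]
  have hkz := h.iterate_mem hz k
  -- the subsequence of the orbit of `z` converges monotonically, and so do nearby orbits
  obtain ⟨w, s, t, hst, hs, ht, hzw, hw⟩ : ∃ w s t : ℝ, s < t ∧ 0 ≤ s ∧ t ≤ 1 ∧
      Filter.Tendsto (fun m => f^[k * m] z) Filter.atTop (nhds w) ∧
      ∀ y ∈ Ioo s t, Filter.Tendsto (fun m => f^[k * m] y) Filter.atTop (nhds w) := by
    rcases lt_or_gt_of_ne hne with hlt | hgt
    · have hn := (mem_homterval_iff_of_le hlt.le hz).1 (homterval_symm hz hrec)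
      have hmono := fun m => (h.iterate_cont_mono hkz.1 hz.2 m (hn m)).2.monotoneOn
      have hanti : Antitone fun m => f^[k * m] z := antitone_nat_of_succ_le fun m => by
        rw [hmul]
        exact hmono (k * m) ⟨le_rfl, hlt.le⟩ ⟨hlt.le, le_rfl⟩ hlt.le
      have hlim := tendsto_atTop_ciInf hanti ⟨0, by
        rintro _ ⟨m, rfl⟩
        exact (h.iterate_mem hz _).1⟩
      refine ⟨_, _, _, hlt, hkz.1, hz.2, hlim, fun y hy => ?_⟩
      refine tendsto_of_tendsto_of_tendsto_of_le_of_le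
        ((Filter.tendsto_add_atTop_iff_nat 1).2 hlim) hlim (fun m => ?_) fun m => ?_
      · simp only [hmul]
        exact hmono (k * m) ⟨le_rfl, hlt.le⟩ ⟨hy.1.le, hy.2.le⟩ hy.1.le
      · exact hmono (k * m) ⟨hy.1.le, hy.2.le⟩ ⟨hlt.le, le_rfl⟩ hy.2.le
    · have hn := (mem_homterval_iff_of_le hgt.le hkz).1 hrec
      have hmono := fun m => (h.iterate_cont_mono hz.1 hkz.2 m (hn m)).2.monotoneOn
      have hmo : Monotone fun m => f^[k * m] z := monotone_nat_of_le_succ fun m => by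
        rw [hmul]
        exact hmono (k * m) ⟨le_rfl, hgt.le⟩ ⟨hgt.le, le_rfl⟩ hgt.le
      have hlim := tendsto_atTop_ciSup hmo ⟨1, by
        rintro _ ⟨m, rfl⟩
        exact (h.iterate_mem hz _).2⟩
      refine ⟨_, _, _, hgt, hz.1, hkz.2, hlim, fun y hy => ?_⟩
      refine tendsto_of_tendsto_of_tendsto_of_le_of_le hlim
        ((Filter.tendsto_add_atTop_iff_nat 1).2 hlim) (fun m => ?_) fun m => ?_
      · exact hmono (k * m) ⟨le_rfl, hgt.le⟩ ⟨hy.1.le, hy.2.le⟩ hy.1.le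
      · simp only [hmul]
        exact hmono (k * m) ⟨hy.1.le, hy.2.le⟩ ⟨hgt.le, le_rfl⟩ hy.2.le
  have hwm : w ∈ Icc (0:ℝ) 1 :=
    isClosed_Icc.mem_of_tendsto hzw (Filter.Eventually.of_forall fun m => h.iterate_mem hz _)
  -- convergence to `w` propagates along the orbit of `w`
  have hprop : ∀ y ∈ Icc (0:ℝ) 1,
      Filter.Tendsto (fun m => f^[k * m] y) Filter.atTop (nhds w) → ∀ n,
      ContinuousWithinAt f^[n] (Icc 0 1) w →
      Filter.Tendsto (fun m => f^[n] (f^[k * m] y)) Filter.atTop (nhds (f^[n] w)) :=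
    fun y hy hyw n hn => hn.tendsto.comp (tendsto_nhdsWithin_iff.2
      ⟨hyw, Filter.Eventually.of_forall fun m => h.iterate_mem hy _⟩)
  have hcont : ∀ n, ContinuousWithinAt f^[n] (Icc 0 1) w := by
    intro n
    induction n with
    | zero => exact continuousWithinAt_id
    | succ n ih =>
      have hmem : f^[n] w ∈ (Ioo (c - e) (c + e))ᶜ :=
        isOpen_Ioo.isClosed_compl.mem_of_tendsto (hprop z hz hzw n ih)
          (Filter.Eventually.of_forall fun m => by
            rw [← Function.iterate_add_apply]
            exact hav _)
      rw [Function.iterate_succ']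
      refine (h.continuousWithinAt (h.iterate_mem hwm n) ?_).comp ih
        fun y hy => h.iterate_mem hy n
      rintro heq
      rw [heq] at hmem
      exact hmem ⟨by linarith, by linarith⟩
  have hper : f^[k] w = w := by
    refine tendsto_nhds_unique (hprop z hz hzw k (hcont k)) ?_
    refine ((Filter.tendsto_add_atTop_iff_nat 1).2 hzw).congr fun m => ?_
    rw [mul_add, mul_one, add_comm, Function.iterate_add_apply]
  refine hNPA w hwm k hk hper ⟨Ioo s t, isOpen_Ioo, nonempty_Ioo.2 hst,
    fun y hy => ⟨hs.trans hy.1.le, hy.2.le.trans ht⟩, fun y hy => ?_⟩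
  have hym : y ∈ Icc (0:ℝ) 1 := ⟨hs.trans hy.1.le, hy.2.le.trans ht⟩
  rw [Metric.tendsto_atTop]
  intro ε hε
  have hev : ∀ᶠ m in Filter.atTop, ∀ r ∈ Finset.range k,
      dist (f^[r] (f^[k * m] y)) (f^[r] w) < ε :=
    (Filter.eventually_all_finset _).2 fun r _ =>
      (Metric.tendsto_nhds.1 (hprop y hym (hw y hy) r (hcont r))) ε hε
  obtain ⟨M, hM⟩ := Filter.eventually_atTop.1 hev
  refine ⟨k * M, fun j hj => ?_⟩
  have hdiv : M ≤ j / k := (Nat.le_div_iff_mul_le (by omega)).2 (by rwa [mul_comm])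
  have hlt := hM _ hdiv (j % k) (Finset.mem_range.2 (Nat.mod_lt _ (by omega)))
  rw [← Function.iterate_add_apply, Nat.mod_add_div] at hlt
  rw [Real.dist_eq, sub_zero, abs_of_nonneg Metric.infDist_nonneg]
  exact (Metric.infDist_le_dist_of_mem (mem_range_self (j % k))).trans_lt hlt

/-- A homterval with summable iterates staying away from `c` can be extended to the right. -/
lemma exists_extension (h : LorenzLike f c) {x e : ℝ} {m : ℕ → ℝ} (hx : x ∈ Icc (0:ℝ) 1)
    (he : 0 < e) (hav : ∀ n, ∀ y ∈ homterval f c (f^[n] x), y ∉ Ioo (c - e) (c + e))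
    (hm : ∀ n, ∀ y ∈ homterval f c (f^[n] x), ∀ z ∈ homterval f c (f^[n] x), z - y ≤ m n)
    (hsum : ∀ n, ∑ i ∈ Finset.range n, m i ≤ 1) :
    ∃ κ, 0 < κ ∧ ∀ s ∈ homterval f c x, ∀ t ∈ homterval f c x, s < t → ∀ w, t ≤ w → w ≤ 1 →
      w - t ≤ κ * (t - s) → w ∈ homterval f c x := by
  obtain ⟨B, hB, hdist⟩ := h.distortion (e / 2) (by linarith)
  set μ := min 1 (e / 2) with hμ
  have hμ0 : 0 < μ := lt_min one_pos (by linarith)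
  refine ⟨Real.exp (-(2 * B)) * μ, by positivity, fun s hs t ht hst w htw hw hwt => ?_⟩
  have key : ∀ n, NoCrit f c n s w ∧ (f^[n] w - f^[n] t) * (t - s) ≤
      Real.exp (B * ∑ i ∈ Finset.range n, 2 * m i) * ((f^[n] t - f^[n] s) * (w - t)) := by
    intro n
    induction n with
    | zero =>
      refine ⟨fun i hi => absurd hi i.not_lt_zero, ?_⟩
      simp [mul_comm]
    | succ n ih =>
      obtain ⟨hnc, hle⟩ := ih
      obtain ⟨hc, hmono⟩ := h.iterate_cont_mono hs.1.1 hw n hnc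
      have ms : s ∈ Icc s w := ⟨le_rfl, by linarith⟩
      have mt : t ∈ Icc s w := ⟨hst.le, htw⟩
      have mw : w ∈ Icc s w := ⟨by linarith, le_rfl⟩
      have hST := hmono ms mt hst
      have hTW := hmono.monotoneOn mt mw htw
      have hsn := h.iterate_homterval hx hs n
      have htn := h.iterate_homterval hx ht n
      have hside := h.same_side hs.1.1 ht.1.2 hst.le n (homterval_noCrit hx hs ht hst.le (n + 1))
      have havs := hav n _ hsn
      have havt := hav n _ htn
      have hmn := hm n _ hsn _ htn
      have hS := (h.iterate_mem hs.1 n).1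
      have hW := (h.iterate_mem (show w ∈ Icc (0:ℝ) 1 from ⟨ht.1.1.trans htw, hw⟩) n).2
      simp only [Function.iterate_succ_apply']
      set S := f^[n] s
      set T := f^[n] t
      set W := f^[n] w
      have hexp : Real.exp (B * ∑ i ∈ Finset.range n, 2 * m i) ≤ Real.exp (2 * B) := by
        rw [Real.exp_le_exp, ← Finset.mul_sum]
        nlinarith [hsum n]
      have hWT : W - T ≤ μ * (T - S) := by
        have h1 : (W - T) * (t - s) ≤ Real.exp (2 * B) *
            ((T - S) * (Real.exp (-(2 * B)) * μ * (t - s))) :=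
          hle.trans (mul_le_mul hexp (mul_le_mul_of_nonneg_left hwt (by linarith))
            (mul_nonneg (by linarith) (by linarith)) (Real.exp_pos _).le)
        have h2 : Real.exp (2 * B) * Real.exp (-(2 * B)) = 1 := by
          rw [← Real.exp_add]
          simp
        have h3 : Real.exp (2 * B) * ((T - S) * (Real.exp (-(2 * B)) * μ * (t - s))) =
            μ * (T - S) * (t - s) := by
          linear_combination (T - S) * μ * (t - s) * h2
        rw [h3] at h1
        exact le_of_mul_le_mul_right h1 (by linarith)
      have hW1 : W - T ≤ T - S := hWT.trans (by nlinarith [min_le_left 1 (e / 2)])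
      have hW2 : W - T ≤ e / 2 := hWT.trans (by nlinarith [min_le_right 1 (e / 2)])
      have hcases : W ≤ c - e / 2 ∨ c + e / 2 ≤ S := by
        rcases hside with hs' | hs'
        · left
          by_contra hcon
          exact havt ⟨by linarith, by linarith⟩
        · right
          by_contra hcon
          exact havs ⟨by linarith, by linarith⟩
      constructor
      · intro i hi z hz
        rcases Nat.lt_succ_iff_lt_or_eq.1 hi with hi | rfl
        · exact hnc i hi z hz
        · have h1 := hmono.monotoneOn ms hz hz.1
          have h2 := hmono.monotoneOn hz mw hz.2
          rcases hcases with h3 | h3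
          · exact ne_of_lt (by linarith)
          · exact ne_of_gt (by linarith)
      · have hd := hdist S T W hS hST hTW hW hcases
        have hfTS : 0 ≤ f T - f S := by
          have h1 := (h.iterate_cont_mono hs.1.1 ht.1.2 (n + 1)
            (homterval_noCrit hx hs ht hst.le (n + 1))).2 ⟨le_rfl, hst.le⟩ ⟨hst.le, le_rfl⟩ hst
          simp only [Function.iterate_succ_apply'] at h1
          exact sub_nonneg.2 h1.le
        rw [Finset.sum_range_succ, mul_add, Real.exp_add]
        set E := Real.exp (B * ∑ i ∈ Finset.range n, 2 * m i)
        have hexp2 : Real.exp (B * (W - S)) ≤ Real.exp (B * (2 * m n)) :=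
          Real.exp_le_exp.2 (mul_le_mul_of_nonneg_left (by linarith) hB)
        have hE : 0 < E := Real.exp_pos _
        refine le_of_mul_le_mul_right ?_ (sub_pos.2 hST)
        calc (f W - f T) * (t - s) * (T - S)
            = (f W - f T) * (T - S) * (t - s) := by ring
          _ ≤ Real.exp (B * (W - S)) * ((f T - f S) * (W - T)) * (t - s) :=
              mul_le_mul_of_nonneg_right hd (by linarith)
          _ = Real.exp (B * (W - S)) * (f T - f S) * ((W - T) * (t - s)) := by ring
          _ ≤ Real.exp (B * (W - S)) * (f T - f S) * (E * ((T - S) * (w - t))) :=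
              mul_le_mul_of_nonneg_left hle (by positivity)
          _ ≤ Real.exp (B * (2 * m n)) * (f T - f S) * (E * ((T - S) * (w - t))) := by
              refine mul_le_mul_of_nonneg_right (mul_le_mul_of_nonneg_right hexp2 hfTS)
                (mul_nonneg hE.le (mul_nonneg (by linarith) (by linarith)))
          _ = E * Real.exp (B * (2 * m n)) * ((f T - f S) * (w - t)) * (T - S) := by ring
  exact homterval_trans hs ((mem_homterval_iff_of_le (by linarith)
    ⟨ht.1.1.trans htw, hw⟩).2 fun n => (key n).1)

lemma false_of_wandering_summable (h : LorenzLike f c) {x e : ℝ} {m : ℕ → ℝ}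
    (hx : x ∈ Icc (0:ℝ) 1) (he : 0 < e)
    (hav : ∀ n, ∀ y ∈ homterval f c (f^[n] x), y ∉ Ioo (c - e) (c + e))
    (hm : ∀ n, ∀ y ∈ homterval f c (f^[n] x), ∀ z ∈ homterval f c (f^[n] x), z - y ≤ m n)
    (hsum : ∀ n, ∑ i ∈ Finset.range n, m i ≤ 1) (hone : (1:ℝ) ∉ homterval f c x)
    {s t : ℝ} (hs : s ∈ homterval f c x) (ht : t ∈ homterval f c x) (hst : s < t) : False := by
  obtain ⟨κ, hκ, hext⟩ := h.exists_extension hx he hav hm hsum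
  have hbdd : BddAbove (homterval f c x) := ⟨1, fun y hy => hy.1.2⟩
  obtain ⟨t', ht', hlt⟩ := exists_lt_of_lt_csSup ⟨t, ht⟩
    (show sSup (homterval f c x) - κ * (t - s) < sSup (homterval f c x) by
      have := mul_pos hκ (sub_pos.2 hst)
      linarith)
  obtain ⟨r, hr, htr, htr'⟩ : ∃ r ∈ homterval f c x, t ≤ r ∧ t' ≤ r := by
    rcases le_total t t' with h1 | h1
    exacts [⟨t', ht', h1, le_rfl⟩, ⟨t, ht, le_rfl, h1⟩]
  have hpos := mul_pos hκ (sub_pos.2 hst)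
  have hle : κ * (t - s) ≤ κ * (r - s) := mul_le_mul_of_nonneg_left (by linarith) hκ.le
  rcases le_total 1 (r + κ * (t - s)) with h1 | h1
  · exact hone (hext s hs r hr (by linarith) 1 hr.1.2 le_rfl (by linarith))
  · have h2 := le_csSup hbdd (hext s hs r hr (by linarith) (r + κ * (t - s)) (by linarith) h1
      (by linarith))
    linarith

lemma not_pairwise_disjoint_homterval (h : LorenzLike f c) {x y e : ℝ} (hx : x ∈ Icc (0:ℝ) 1)
    (he : 0 < e) (hav : ∀ n, f^[n] x ∉ Ioo (c - e) (c + e)) (hy : y ∈ homterval f c x)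
    (hxy : x < y)
    (hdisj : Pairwise (Function.onFun Disjoint fun n => homterval f c (f^[n] x))) : False := by
  set V : ℕ → Set ℝ := fun n => homterval f c (f^[n] x) with hV
  have hxc : ∀ n, f^[n] x ≠ c := fun n hn => hav n (by rw [hn]; exact ⟨by linarith, by linarith⟩)
  have hself : ∀ n, f^[n] x ∈ V n := fun n =>
    homterval_self (h.iterate_mem hx n) fun k => by
      rw [← Function.iterate_add_apply]
      exact hxc _
  have htsum : ∑' n, MeasureTheory.volume (V n) ≤ 1 := by
    rw [← MeasureTheory.measure_iUnion hdisj fun n => (homterval_ordConnected _).measurableSet]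
    calc MeasureTheory.volume (⋃ n, V n) ≤ MeasureTheory.volume (Icc (0:ℝ) 1) :=
          MeasureTheory.measure_mono (iUnion_subset fun n y hy => hy.1)
      _ = 1 := by simp
  have htop : ∑' n, MeasureTheory.volume (V n) ≠ ⊤ :=
    (htsum.trans_lt ENNReal.one_lt_top).ne
  have hfin : ∀ n, MeasureTheory.volume (V n) ≠ ⊤ := ENNReal.ne_top_of_tsum_ne_top htop
  set m : ℕ → ℝ := fun n => (MeasureTheory.volume (V n)).toReal with hm
  have hms : Summable m := ENNReal.summable_toReal htop
  have hmle : ∀ n, ∀ y ∈ V n, ∀ z ∈ V n, z - y ≤ m n := by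
    intro n y hy z hz
    rcases le_total z y with hzy | hyz
    · exact (sub_nonpos.2 hzy).trans ENNReal.toReal_nonneg
    · have h1 : MeasureTheory.volume (Icc y z) ≤ MeasureTheory.volume (V n) :=
        MeasureTheory.measure_mono ((homterval_ordConnected _).out hy hz)
      have h2 := ENNReal.toReal_mono (hfin n) h1
      rwa [Real.volume_Icc, ENNReal.toReal_ofReal (sub_nonneg.2 hyz)] at h2
  have hsum1 : ∑' n, m n ≤ 1 := by
    rw [← ENNReal.tsum_toReal_eq hfin]
    exact ENNReal.toReal_le_of_le_ofReal zero_le_one (by simpa using htsum)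
  obtain ⟨N, hN⟩ := Filter.eventually_atTop.1
    (hms.tendsto_atTop_zero.eventually_lt_const (show (0:ℝ) < e / 2 by linarith))
  have hshift : ∀ n, f^[n] (f^[N] x) = f^[n + N] x := fun n =>
    (Function.iterate_add_apply f n N x).symm
  have hNy := (h.iterate_cont_mono hx.1 hy.1.2 N (homterval_noCrit hx (hself 0) hy hxy.le N)).2
    ⟨le_rfl, hxy.le⟩ ⟨hxy.le, le_rfl⟩ hxy
  refine h.false_of_wandering_summable (x := f^[N] x) (m := fun n => m (n + N))
    (h.iterate_mem hx N) (half_pos he) ?_ ?_ ?_ ?_ (hself N) (h.iterate_homterval hx hy N) hNy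
  · intro n z hz hze
    rw [hshift] at hz
    have h1 := hmle _ _ hz _ (hself (n + N))
    have h2 := hmle _ _ (hself (n + N)) _ hz
    have h3 := hN (n + N) (by omega)
    exact hav (n + N) ⟨by linarith [hze.1], by linarith [hze.2]⟩
  · intro n
    rw [hshift]
    exact hmle _
  · intro n
    have h1 := Finset.sum_range_add m N n
    have h2 : 0 ≤ ∑ i ∈ Finset.range N, m i :=
      Finset.sum_nonneg fun i _ => ENNReal.toReal_nonneg
    have h3 := hms.sum_le_tsum (Finset.range (N + n)) fun i _ => ENNReal.toReal_nonneg
    simp only [add_comm _ N]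
    linarith
  · intro h1
    have h2 := h.map_homterval (h.iterate_mem hx N) h1
    rw [h.map_one, ← Function.iterate_succ_apply' f N x] at h2
    exact disjoint_left.1 (hdisj (show N ≠ N + 1 by omega)) h1 h2

/-- Every nondegenerate interval eventually meets any given neighbourhood of `c`. -/
theorem exists_iterate_mem (h : LorenzLike f c) (hNPA : NoPeriodicAttractor f) {s t e : ℝ}
    (hs : 0 ≤ s) (hst : s < t) (ht : t ≤ 1) (he : 0 < e) :
    ∃ n, ∃ z ∈ Icc s t, f^[n] z ∈ Ioo (c - e) (c + e) := by
  by_contra! hcon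
  have hm : ∀ z ∈ Icc s t, z ∈ Icc (0:ℝ) 1 := fun z hz => ⟨hs.trans hz.1, hz.2.trans ht⟩
  have hsm := hm s ⟨le_rfl, hst.le⟩
  have hne : ∀ z ∈ Icc s t, ∀ n, f^[n] z ≠ c := fun z hz n hn =>
    hcon n z hz (by rw [hn]; exact ⟨by linarith, by linarith⟩)
  have hhom : ∀ z ∈ Icc s t, z ∈ homterval f c s := fun z hz =>
    (mem_homterval_iff_of_le hz.1 (hm z hz)).2 fun n i _ y hy =>
      hne y ⟨hy.1, hy.2.trans hz.2⟩ i
  have hnd : ¬ Pairwise (Function.onFun Disjoint fun n => homterval f c (f^[n] s)) := fun hd =>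
    h.not_pairwise_disjoint_homterval hsm he (fun n => hcon n s ⟨le_rfl, hst.le⟩)
      (hhom t ⟨hst.le, le_rfl⟩) hst hd
  obtain ⟨i, j, hij, v, hvi, hvj⟩ : ∃ i j, i < j ∧ ∃ v, v ∈ homterval f c (f^[i] s) ∧
      v ∈ homterval f c (f^[j] s) := by
    simp only [Pairwise, Function.onFun, disjoint_left] at hnd
    push Not at hnd
    obtain ⟨i, j, hij, v, h1, h2⟩ := hnd
    rcases lt_or_gt_of_ne hij with h3 | h3
    exacts [⟨i, j, h3, v, h1, h2⟩, ⟨j, i, h3, v, h2, h1⟩]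
  obtain ⟨k, rfl⟩ := Nat.exists_eq_add_of_lt hij
  have hji : f^[i + k + 1] s ∈ homterval f c (f^[i] s) :=
    homterval_trans hvi (homterval_symm (h.iterate_mem hsm _) hvj)
  have hnc := homterval_noCrit hsm (hhom s ⟨le_rfl, hst.le⟩) (hhom t ⟨hst.le, le_rfl⟩) hst.le
  refine h.not_iterate_eq_id (h.iterate_mem hsm i).1
    (h.iterate_mem (hm t ⟨hst.le, le_rfl⟩) i).2
    ((h.iterate_cont_mono hs ht i (hnc i)).2 ⟨le_rfl, hst.le⟩ ⟨hst.le, le_rfl⟩ hst)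
    (n := k) ?_ ?_
  · exact homterval_noCrit (h.iterate_mem hsm i)
      (h.iterate_homterval hsm (hhom s ⟨le_rfl, hst.le⟩) i)
      (h.iterate_homterval hsm (hhom t ⟨hst.le, le_rfl⟩) i)
      ((h.iterate_cont_mono hs ht i (hnc i)).2 ⟨le_rfl, hst.le⟩ ⟨hst.le, le_rfl⟩ hst).le _
  · intro y hy
    obtain ⟨z, hz, rfl⟩ := h.image_Icc hs ht hst.le i (hnc i) hy
    have hshift : f^[k + 1] (f^[i] z) = f^[i + k + 1] z := by
      rw [← Function.iterate_add_apply, add_comm (k + 1), add_assoc]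
    refine h.iterate_eq_of_mem_homterval hNPA (h.iterate_mem (hm z hz) i) k.succ_pos he
      (fun n => ?_) ?_
    · rw [← Function.iterate_add_apply]
      exact hcon _ z hz
    · rw [hshift]
      exact homterval_trans (homterval_symm (h.iterate_mem hsm i)
        (h.iterate_homterval hsm (hhom z hz) i))
        (homterval_trans hji (h.iterate_homterval hsm (hhom z hz) _))

end LorenzLike

/-- The first `n` iterates of `[s, t]` avoid the `e`-neighbourhood of `c`. -/
def AvoidsCrit (f : ℝ → ℝ) (c e : ℝ) (n : ℕ) (s t : ℝ) : Prop :=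
  ∀ i < n, ∀ z ∈ Icc s t, f^[i] z ∉ Ioo (c - e) (c + e)

lemma AvoidsCrit.noCrit {f : ℝ → ℝ} {c e : ℝ} {n : ℕ} {s t : ℝ} (h : AvoidsCrit f c e n s t)
    (he : 0 < e) : NoCrit f c n s t := fun i hi z hz hzc =>
  h i hi z hz (by rw [hzc]; exact ⟨by linarith, by linarith⟩)

/-- If every point of `Γ` sees, at arbitrarily small scales, a gap of `Γ` to its right which is
comparable to its distance from the point, then `Γ` has measure zero. -/
lemma volume_eq_zero_of_right_porous {Γ : Set ℝ}
    (h : ∀ x ∈ Γ, ∃ κ, 0 < κ ∧ ∀ δ, 0 < δ → ∃ q r, x ≤ q ∧ q < r ∧ r ≤ x + δ ∧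
      Disjoint (Ioo q r) Γ ∧ κ * (q - x) ≤ r - q) : MeasureTheory.volume Γ = 0 := by
  have hae := IsUnifLocDoublingMeasure.ae_tendsto_measure_inter_div
    (MeasureTheory.volume : MeasureTheory.Measure ℝ) Γ 1
  rw [MeasureTheory.ae_iff] at hae
  refine le_antisymm (le_trans ?_ ((MeasureTheory.Measure.le_restrict_apply Γ _).trans hae.le))
    bot_le
  refine MeasureTheory.measure_mono fun x hx => ⟨fun hden => ?_, hx⟩
  obtain ⟨κ, hκ, hgap⟩ := h x hx
  choose q r hxq hqr hr hdisj hqr' using fun n : ℕ => hgap (1 / ((n:ℝ) + 1)) (by positivity)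
  have hlim : Filter.Tendsto (fun n => (r n - x) / 2) Filter.atTop (nhdsWithin 0 (Ioi 0)) := by
    refine tendsto_nhdsWithin_iff.2 ⟨?_, Filter.Eventually.of_forall fun n => ?_⟩
    · refine tendsto_of_tendsto_of_tendsto_of_le_of_le tendsto_const_nhds
        (tendsto_one_div_add_atTop_nhds_zero_nat (𝕜 := ℝ)) (fun n => ?_) fun n => ?_
      · show 0 ≤ (r n - x) / 2
        linarith [hxq n, hqr n]
      · show (r n - x) / 2 ≤ 1 / ((n:ℝ) + 1)
        linarith [hxq n, hqr n, hr n]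
    · show 0 < (r n - x) / 2
      linarith [hxq n, hqr n]
  have hball : ∀ n, Metric.closedBall ((x + r n) / 2) ((r n - x) / 2) = Icc x (r n) := fun n => by
    rw [Real.closedBall_eq_Icc]
    congr 1 <;> ring
  have hone := hden (fun n => (x + r n) / 2) (fun n => (r n - x) / 2) hlim
    (Filter.Eventually.of_forall fun n => by
      rw [one_mul, hball]
      exact ⟨le_rfl, by linarith [hxq n, hqr n]⟩)
  refine absurd (le_of_tendsto hone (b := ENNReal.ofReal (1 / (1 + κ)))
    (Filter.Eventually.of_forall fun n => ?_)) (not_le.2 ?_)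
  · have hpos : 0 < r n - x := by linarith [hxq n, hqr n]
    have hsub : Γ ∩ Icc x (r n) ⊆ Icc x (q n) ∪ {r n} := fun y hy => by
      by_contra hcon
      simp only [mem_union, mem_Icc, mem_singleton_iff, not_or, not_and, not_le] at hcon
      exact disjoint_left.1 (hdisj n) ⟨hcon.1 hy.2.1, lt_of_le_of_ne hy.2.2 hcon.2⟩ hy.1
    have hvol : MeasureTheory.volume (Γ ∩ Icc x (r n)) ≤ ENNReal.ofReal (q n - x) := by
      refine (MeasureTheory.measure_mono hsub).trans ((MeasureTheory.measure_union_le _ _).trans ?_)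
      simp
    rw [hball, Real.volume_Icc]
    refine ENNReal.div_le_of_le_mul (hvol.trans ?_)
    rw [← ENNReal.ofReal_mul (by positivity)]
    refine ENNReal.ofReal_le_ofReal ?_
    rw [div_mul_eq_mul_div, one_mul, le_div_iff₀ (by linarith)]
    linarith [hqr' n]
  · rw [← ENNReal.ofReal_one]
    refine (ENNReal.ofReal_lt_ofReal_iff one_pos).2 ?_
    rw [div_lt_one (by linarith)]
    linarith

namespace LorenzLike

variable {f : ℝ → ℝ} {c : ℝ}

lemma exists_le_length (h : LorenzLike f c) (hNPA : NoPeriodicAttractor f) {s t e : ℝ}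
    (hs : 0 ≤ s) (hst : s < t) (ht : t ≤ 1) (he : 0 < e) :
    ∃ ε, 0 < ε ∧ ∀ n, AvoidsCrit f c e n s t → ε ≤ f^[n] t - f^[n] s := by
  have hpos : ∀ n, AvoidsCrit f c e n s t → 0 < f^[n] t - f^[n] s := fun n hn =>
    sub_pos.2 ((h.iterate_cont_mono hs ht n (hn.noCrit he)).2 ⟨le_rfl, hst.le⟩
      ⟨hst.le, le_rfl⟩ hst)
  obtain ⟨N, z, hz, hzN⟩ := h.exists_iterate_mem hNPA hs hst ht he
  have hfin : ∀ K, ∃ ε, 0 < ε ∧ ∀ n < K, AvoidsCrit f c e n s t → ε ≤ f^[n] t - f^[n] s := by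
    intro K
    induction K with
    | zero => exact ⟨1, one_pos, fun n hn => absurd hn n.not_lt_zero⟩
    | succ K ih =>
      obtain ⟨ε, hε, hle⟩ := ih
      by_cases hK : AvoidsCrit f c e K s t
      · refine ⟨min ε (f^[K] t - f^[K] s), lt_min hε (hpos K hK), fun n hn hav => ?_⟩
        rcases Nat.lt_succ_iff_lt_or_eq.1 hn with hn | rfl
        · exact (min_le_left _ _).trans (hle n hn hav)
        · exact min_le_right _ _
      · refine ⟨ε, hε, fun n hn hav => ?_⟩
        rcases Nat.lt_succ_iff_lt_or_eq.1 hn with hn | rfl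
        · exact hle n hn hav
        · exact absurd hav hK
  obtain ⟨ε, hε, hle⟩ := hfin (N + 1)
  refine ⟨ε, hε, fun n hn => hle n ?_ hn⟩
  by_contra hcon
  exact hn N (by omega) z hz hzN

/-- To the left of a point avoiding `(a, b)` there are, for all times, intervals which are mapped
diffeomorphically onto intervals of definite size. -/
lemma exists_left (h : LorenzLike f c) (hNPA : NoPeriodicAttractor f) {x a b e : ℝ}
    (hx : x ∈ Ioo (0:ℝ) 1) (he : 0 < e) (hae : a < c - e) (hbe : c + e < b) (hb : b ≤ 1)
    (hav : ∀ n, f^[n] x ∉ Ioo a b) :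
    ∃ ε, 0 < ε ∧ ∀ n, ∃ p, 0 < p ∧ p < x ∧ AvoidsCrit f c e n p x ∧ ε ≤ f^[n] x - f^[n] p := by
  obtain ⟨hx0, hx1⟩ := hx
  have hc0 := h.c_mem.1
  obtain ⟨ε₁, hε₁, hle₁⟩ := h.exists_le_length hNPA (s := x / 2) (t := x) (by linarith)
    (by linarith) hx1.le he
  obtain ⟨ε₂, hε₂, hle₂⟩ := h.exists_le_length hNPA (s := c + e) (t := b) (by linarith)
    hbe hb he
  refine ⟨min ε₁ ε₂, lt_min hε₁ hε₂, fun n => ?_⟩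
  suffices H : ∃ p, 0 < p ∧ p < x ∧ AvoidsCrit f c e n p x ∧ ∃ s t k,
      ((s = x / 2 ∧ t = x) ∨ (s = c + e ∧ t = b)) ∧ AvoidsCrit f c e k s t ∧
      f^[n] p = f^[k] s ∧ f^[k] t ≤ f^[n] x by
    obtain ⟨p, hp0, hpx, hp, s, t, k, ⟨rfl, rfl⟩ | ⟨rfl, rfl⟩, hk, h1, h2⟩ := H
    · exact ⟨p, hp0, hpx, hp, (min_le_left _ _).trans (by linarith [hle₁ k hk])⟩
    · exact ⟨p, hp0, hpx, hp, (min_le_right _ _).trans (by linarith [hle₂ k hk])⟩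
  induction n with
  | zero =>
    exact ⟨x / 2, by linarith, by linarith, fun i hi => absurd hi i.not_lt_zero, x / 2, x, 0,
      Or.inl ⟨rfl, rfl⟩, fun i hi => absurd hi i.not_lt_zero, rfl, le_rfl⟩
  | succ n ih =>
    obtain ⟨p, hp0, hpx, hp, s, t, k, hst, hk, h1, h2⟩ := ih
    have hmono := (h.iterate_cont_mono hp0.le hx1.le n (hp.noCrit he)).2
    have hs0 : 0 ≤ s := by rcases hst with ⟨rfl, -⟩ | ⟨rfl, -⟩ <;> linarith
    have ht1 : t ≤ 1 := by rcases hst with ⟨-, rfl⟩ | ⟨-, rfl⟩ <;> linarith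
    have hst' : s < t := by rcases hst with ⟨rfl, rfl⟩ | ⟨rfl, rfl⟩ <;> linarith
    by_cases hcut : ∃ z ∈ Icc p x, f^[n] z ∈ Ioo (c - e) (c + e)
    · obtain ⟨z, hz, hz1, hz2⟩ := hcut
      have hpz := hmono.monotoneOn ⟨le_rfl, hpx.le⟩ hz hz.1
      have hzx := hmono.monotoneOn hz ⟨hpx.le, le_rfl⟩ hz.2
      have hxb : b ≤ f^[n] x := by
        by_contra hcon
        exact hav n ⟨by linarith, by linarith⟩
      obtain ⟨p', hp', hpn⟩ := h.image_Icc hp0.le hx1.le hpx.le n (hp.noCrit he)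
        (show c + e ∈ Icc (f^[n] p) (f^[n] x) from ⟨by linarith, by linarith⟩)
      have hpx' : p' < x := by
        refine lt_of_le_of_ne hp'.2 ?_
        rintro rfl
        linarith
      refine ⟨p', hp0.trans_le hp'.1, hpx', fun i hi y hy => ?_, c + e, b, 1, Or.inr ⟨rfl, rfl⟩,
        fun i hi y hy => ?_, ?_, ?_⟩
      · have hy' : y ∈ Icc p x := ⟨hp'.1.trans hy.1, hy.2⟩
        rcases Nat.lt_succ_iff_lt_or_eq.1 hi with hi | rfl
        · exact hp i hi y hy'
        · have := hmono.monotoneOn hp' hy' hy.1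
          exact fun hcon => by linarith [hcon.2]
      · obtain rfl : i = 0 := by omega
        exact fun hcon => absurd hcon.2 (not_lt.2 hy.1)
      · rw [Function.iterate_succ_apply', hpn, Function.iterate_one]
      · rw [Function.iterate_one, Function.iterate_succ_apply']
        exact h.mono_right.monotoneOn ⟨by linarith, hb⟩
          ⟨by linarith, (h.iterate_mem ⟨hx0.le, hx1.le⟩ n).2⟩ hxb
    · push Not at hcut
      have hp' : AvoidsCrit f c e (n + 1) p x := fun i hi y hy => by
        rcases Nat.lt_succ_iff_lt_or_eq.1 hi with hi | rfl
        exacts [hp i hi y hy, hcut y hy]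
      have hmonok := (h.iterate_cont_mono hs0 ht1 k (hk.noCrit he)).2
      have hst'' := hmonok ⟨le_rfl, hst'.le⟩ ⟨hst'.le, le_rfl⟩ hst'
      refine ⟨p, hp0, hpx, hp', s, t, k + 1, hst, fun i hi y hy => ?_, ?_, ?_⟩
      · rcases Nat.lt_succ_iff_lt_or_eq.1 hi with hi | rfl
        · exact hk i hi y hy
        · have hys := hmonok.monotoneOn ⟨le_rfl, hst'.le⟩ hy hy.1
          have hyt := hmonok.monotoneOn hy ⟨hst'.le, le_rfl⟩ hy.2
          obtain ⟨y', hy', heq⟩ := h.image_Icc hp0.le hx1.le hpx.le n (hp.noCrit he)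
            (show f^[i] y ∈ Icc (f^[n] p) (f^[n] x) from ⟨by linarith, by linarith⟩)
          rw [← heq]
          exact hcut y' hy'
      · simp only [Function.iterate_succ_apply', h1]
      · simp only [Function.iterate_succ_apply']
        have hxm := h.iterate_mem (show x ∈ Icc (0:ℝ) 1 from ⟨hx0.le, hx1.le⟩) n
        have htm := h.iterate_mem (show t ∈ Icc (0:ℝ) 1 from ⟨by linarith, ht1⟩) k
        rcases h.same_side hp0.le hx1.le hpx.le n (hp'.noCrit he) with hside | hside
        · exact h.mono_left.monotoneOn ⟨htm.1, by linarith⟩ ⟨hxm.1, hside⟩ h2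
        · exact h.mono_right.monotoneOn ⟨by linarith, htm.2⟩ ⟨by linarith, hxm.2⟩ h2

/-- Points avoiding `(a, b)` see gaps to their right at all scales. -/
lemma exists_gap (h : LorenzLike f c) (hNPA : NoPeriodicAttractor f) {x a b e : ℝ}
    (hx : x ∈ Ioo (0:ℝ) 1) (he : 0 < e) (hae : a < c - e) (hbe : c + e < b) (hb : b ≤ 1)
    (hav : ∀ n, f^[n] x ∉ Ioo a b) :
    ∃ κ, 0 < κ ∧ ∀ δ, 0 < δ → ∃ q r, x ≤ q ∧ q < r ∧ r ≤ x + δ ∧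
      (∀ z ∈ Ioo q r, ∃ n, f^[n] z ∈ Ioo a b) ∧ κ * (q - x) ≤ r - q := by
  obtain ⟨ε, hε, hleft⟩ := h.exists_left hNPA hx he hae hbe hb hav
  refine ⟨ε * (c - e - a), mul_pos hε (by linarith), fun δ hδ => ?_⟩
  obtain ⟨hx0, hx1⟩ := hx
  obtain ⟨y, hxy, hyδ, hy1⟩ : ∃ y, x < y ∧ y ≤ x + δ ∧ y < 1 := by
    refine ⟨min (x + δ) ((x + 1) / 2), lt_min (by linarith) (by linarith), min_le_left _ _, ?_⟩
    exact (min_le_right _ _).trans_lt (by linarith)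
  classical
  have hex := h.exists_iterate_mem hNPA hx0.le hxy hy1.le he
  set n := Nat.find hex with hn
  obtain ⟨z, hz, hz1, hz2⟩ := Nat.find_spec hex
  rw [← hn] at hz1 hz2
  have havn : AvoidsCrit f c e n x y := fun i hi w hw hcon => Nat.find_min hex hi ⟨w, hw, hcon⟩
  obtain ⟨hcont, hmono⟩ := h.iterate_cont_mono hx0.le hy1.le n (havn.noCrit he)
  have mx : x ∈ Icc x y := ⟨le_rfl, hxy.le⟩
  have hxz := hmono.monotoneOn mx hz hz.1
  have hxa : f^[n] x ≤ a := by
    by_contra hcon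
    exact hav n ⟨by linarith, by linarith⟩
  have hzy : NoCrit f c n x z := fun i hi w hw => havn.noCrit he i hi w ⟨hw.1, hw.2.trans hz.2⟩
  obtain ⟨q, hq, hqa⟩ := h.image_Icc hx0.le (hz.2.trans hy1.le) hz.1 n hzy
    (show a ∈ Icc (f^[n] x) (f^[n] z) from ⟨hxa, by linarith⟩)
  obtain ⟨r, hr, hra⟩ := h.image_Icc hx0.le (hz.2.trans hy1.le) hz.1 n hzy
    (show c - e ∈ Icc (f^[n] x) (f^[n] z) from ⟨by linarith, by linarith⟩)
  have mq : q ∈ Icc x y := ⟨hq.1, hq.2.trans hz.2⟩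
  have mr : r ∈ Icc x y := ⟨hr.1, hr.2.trans hz.2⟩
  have hqr : q < r := (hmono.lt_iff_lt mq mr).1 (by rw [hqa, hra]; exact hae)
  refine ⟨q, r, hq.1, hqr, mr.2.trans hyδ, fun w hw => ⟨n, ?_⟩, ?_⟩
  · have mw : w ∈ Icc x y := ⟨hq.1.trans hw.1.le, hw.2.le.trans mr.2⟩
    have h1 := hmono mq mw hw.1
    have h2 := hmono mw mr hw.2
    exact ⟨by linarith, by linarith⟩
  · rcases hq.1.eq_or_lt with rfl | hxq
    · simp only [sub_self, mul_zero]
      linarith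
    obtain ⟨p, hp0, hpx, hp, hpε⟩ := hleft n
    have hnc : NoCrit f c n p r := fun i hi w hw => by
      rcases le_total w x with hwx | hwx
      · exact hp.noCrit he i hi w ⟨hw.1, hwx⟩
      · exact havn.noCrit he i hi w ⟨hwx, hw.2.trans mr.2⟩
    have hcr := h.crossRatio_iterate_le hp0 hpx hxq hqr (mr.2.trans_lt hy1) n hnc
    have hP := (h.iterate_mem (show p ∈ Icc (0:ℝ) 1 from ⟨hp0.le, by linarith⟩) n).1
    have hR := (h.iterate_mem (show r ∈ Icc (0:ℝ) 1 from ⟨by linarith, by linarith [mr.2]⟩) n).2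
    have hX := hmono mx mq hxq
    rw [hqa] at hX
    rw [hra] at hR
    rw [crossRatio, crossRatio, hqa, hra] at hcr
    set X := f^[n] x
    set P := f^[n] p
    have h1 : ε * (c - e - a) ≤ (X - P) * (c - e - a) / ((c - e - P) * (a - X)) := by
      rw [le_div_iff₀ (mul_pos (by linarith) (by linarith))]
      have h3 : (c - e - P) * (a - X) ≤ 1 :=
        mul_le_one₀ (by linarith) (by linarith) (by linarith)
      calc ε * (c - e - a) * ((c - e - P) * (a - X)) ≤ ε * (c - e - a) * 1 :=
            mul_le_mul_of_nonneg_left h3 (mul_nonneg hε.le (by linarith))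
        _ ≤ (X - P) * (c - e - a) := by
            rw [mul_one]
            exact mul_le_mul_of_nonneg_right hpε (by linarith)
    have h2 : (x - p) * (r - q) / ((r - p) * (q - x)) ≤ (r - q) / (q - x) := by
      rw [div_le_div_iff₀ (mul_pos (by linarith) (by linarith)) (by linarith)]
      have h3 : 0 ≤ (r - q) * (q - x) := mul_nonneg (by linarith) (by linarith)
      nlinarith
    have h3 := h1.trans (hcr.trans h2)
    rwa [le_div_iff₀ (by linarith)] at h3

theorem volume_avoidSet (h : LorenzLike f c) (hNPA : NoPeriodicAttractor f) {a b : ℝ}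
    (hac : a < c) (hcb : c < b) (hb : b ≤ 1) : MeasureTheory.volume (avoidSet f a b) = 0 := by
  obtain ⟨e, he, hae, hbe⟩ : ∃ e, 0 < e ∧ a < c - e ∧ c + e < b := by
    have h1 : 0 < min (c - a) (b - c) := lt_min (by linarith) (by linarith)
    refine ⟨min (c - a) (b - c) / 2, by linarith, ?_, ?_⟩
    · linarith [min_le_left (c - a) (b - c)]
    · linarith [min_le_right (c - a) (b - c)]
  have hint : MeasureTheory.volume (avoidSet f a b ∩ Ioo 0 1) = 0 := by
    refine volume_eq_zero_of_right_porous fun x hx => ?_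
    obtain ⟨κ, hκ, hgap⟩ := h.exists_gap hNPA hx.2 he hae hbe hb hx.1.2
    refine ⟨κ, hκ, fun δ hδ => ?_⟩
    obtain ⟨q, r, h1, h2, h3, h4, h5⟩ := hgap δ hδ
    refine ⟨q, r, h1, h2, h3, disjoint_left.2 fun z hz hzΓ => ?_, h5⟩
    obtain ⟨n, hn⟩ := h4 z hz
    exact hzΓ.1.2 n hn
  have hsub : avoidSet f a b ⊆ avoidSet f a b ∩ Ioo 0 1 ∪ {0, 1} := fun x hx => by
    by_cases h0 : x = 0
    · exact Or.inr (by simp [h0])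
    by_cases h1 : x = 1
    · exact Or.inr (by simp [h1])
    exact Or.inl ⟨hx, lt_of_le_of_ne hx.1.1 (Ne.symm h0), lt_of_le_of_ne hx.1.2 h1⟩
  refine MeasureTheory.measure_mono_null hsub (MeasureTheory.measure_union_null hint ?_)
  exact (Set.toFinite {(0:ℝ), 1}).measure_zero _

end LorenzLike

/-- The infinitesimal form of cross-ratio expansion. -/
lemma mul_deriv_lt_of_strictConvexOn {g g₁ : ℝ → ℝ} {I : Set ℝ}
    (hI : I.OrdConnected) (hg : ∀ x ∈ I, HasDerivAt g (g₁ x) x) (hpos : ∀ x ∈ I, 0 < g₁ x)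
    (hconv : StrictConvexOn ℝ I fun x => (√(g₁ x))⁻¹) {x y : ℝ} (hx : x ∈ I) (hy : y ∈ I)
    (hxy : x < y) : g₁ x * g₁ y * (y - x) ^ 2 < (g y - g x) ^ 2 := by
  have hsub : Icc x y ⊆ I := hI.out hx hy
  set k : ℝ → ℝ := fun x => (√(g₁ x))⁻¹ with hk
  have hkpos : ∀ z ∈ I, 0 < k z := fun z hz => inv_pos.2 (Real.sqrt_pos.2 (hpos z hz))
  have hksq : ∀ z ∈ I, g₁ z = (k z ^ 2)⁻¹ := fun z hz => by
    rw [hk]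
    simp only [inv_pow, inv_inv]
    exact (Real.sq_sqrt (hpos z hz).le).symm
  have hd : 0 < y - x := sub_pos.2 hxy
  set l : ℝ → ℝ := fun z => (k x * (y - z) + k y * (z - x)) / (y - x) with hl
  have hly : l y = k y := by simp only [hl]; field_simp; ring
  have hlpos : ∀ z ∈ Icc x y, 0 < l z := fun z hz => by
    refine div_pos ?_ hd
    have h1 := hkpos x hx
    have h2 := hkpos y hy
    rcases hz.1.eq_or_lt with rfl | h3
    · nlinarith
    · nlinarith [mul_pos h2 (sub_pos.2 h3), mul_nonneg h1.le (sub_nonneg.2 hz.2)]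
  have hlt : ∀ z ∈ Ioo x y, k z < l z := fun z hz => by
    have h1 := hconv.2 hx hy hxy.ne (div_pos (sub_pos.2 hz.2) hd) (div_pos (sub_pos.2 hz.1) hd)
      (by field_simp; ring)
    simp only [smul_eq_mul] at h1
    have h2 : (y - z) / (y - x) * x + (z - x) / (y - x) * y = z := by field_simp; ring
    rw [h2] at h1
    calc k z < _ := h1
      _ = l z := by simp only [hl, hk]; field_simp
  set P : ℝ → ℝ := fun z => (z - x) / (k x * l z) with hP
  have hlderiv : ∀ z, HasDerivAt l ((k y - k x) / (y - x)) z := fun z => by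
    have h1 : HasDerivAt (fun z => k x * (y - z) + k y * (z - x)) (k x * (-1) + k y * 1) z :=
      (((hasDerivAt_id z).const_sub y).const_mul (k x)).add
        (((hasDerivAt_id z).sub_const x).const_mul (k y))
    exact (h1.div_const (y - x)).congr_deriv (by ring)
  have hPderiv : ∀ z ∈ Icc x y, HasDerivAt P ((l z ^ 2)⁻¹) z := fun z hz => by
    have h1 : HasDerivAt P ((1 * (k x * l z) - (z - x) * (k x * ((k y - k x) / (y - x)))) /
        (k x * l z) ^ 2) z := ((hasDerivAt_id z).sub_const x).div ((hlderiv z).const_mul (k x))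
      (mul_pos (hkpos x hx) (hlpos z hz)).ne'
    refine h1.congr_deriv ?_
    have h2 := (hkpos x hx).ne'
    have h3 := (hlpos z hz).ne'
    have h4 : l z - (z - x) * ((k y - k x) / (y - x)) = k x := by
      simp only [hl]; field_simp; ring
    rw [inv_eq_one_div, div_eq_div_iff (by positivity) (by positivity)]
    linear_combination (k x * l z ^ 2) * h4
  have hmono : StrictMonoOn (fun z => g z - P z) (Icc x y) := by
    refine strictMonoOn_of_deriv_pos (convex_Icc x y) (fun z hz =>
      ((hg z (hsub hz)).sub (hPderiv z hz)).continuousAt.continuousWithinAt) fun z hz => ?_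
    rw [interior_Icc] at hz
    have hz' := Ioo_subset_Icc_self hz
    have h0 : HasDerivAt (fun z => g z - P z) (g₁ z - (l z ^ 2)⁻¹) z :=
      (hg z (hsub hz')).sub (hPderiv z hz')
    rw [h0.deriv, hksq z (hsub hz'), sub_pos]
    have h1 := hlt z hz
    have h2 := hkpos z (hsub hz')
    exact inv_strictAnti₀ (by positivity) (by gcongr)
  have h1 := hmono ⟨le_rfl, hxy.le⟩ ⟨hxy.le, le_rfl⟩ hxy
  have h2 : P x = 0 := by simp [hP]
  have h3 : P y = (y - x) / (k x * k y) := by simp only [hP, hly]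
  simp only [h2, h3] at h1
  have h4 : 0 < (y - x) / (k x * k y) := div_pos hd (mul_pos (hkpos x hx) (hkpos y hy))
  have h5 : ((y - x) / (k x * k y)) ^ 2 < (g y - g x) ^ 2 := by
    refine pow_lt_pow_left₀ (by linarith) h4.le (by norm_num)
  rw [hksq x hx, hksq y hy]
  calc (k x ^ 2)⁻¹ * (k y ^ 2)⁻¹ * (y - x) ^ 2 = ((y - x) / (k x * k y)) ^ 2 := by
        have := (hkpos x hx).ne'
        have := (hkpos y hy).ne'
        field_simp
    _ < _ := h5

lemma crossRatio_eq {p q r s : ℝ} (hpq : p < q) (hqr : q < r) (hrs : r < s) :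
    crossRatio p q r s = (r - p) * (s - q) / ((r - q) * (s - p)) - 1 := by
  have h1 : r - q ≠ 0 := by linarith
  have h2 : s - p ≠ 0 := by linarith
  rw [crossRatio]
  field_simp
  ring

/-- The infinitesimal form of cross-ratio expansion implies the global one. -/
lemma crossRatio_lt_of_mul_deriv_lt {g g₁ : ℝ → ℝ} {I : Set ℝ}
    (hI : I.OrdConnected) (hg : ∀ x ∈ I, HasDerivAt g (g₁ x) x) (hmono : StrictMonoOn g I)
    (hker : ∀ x ∈ I, ∀ y ∈ I, x < y → g₁ x * g₁ y * (y - x) ^ 2 < (g y - g x) ^ 2)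
    {p q r s : ℝ} (hp : p ∈ I) (hs : s ∈ I) (hpq : p < q) (hqr : q < r) (hrs : r < s) :
    crossRatio (g p) (g q) (g r) (g s) < crossRatio p q r s := by
  have hsub : Icc p s ⊆ I := hI.out hp hs
  have hq : q ∈ I := hsub ⟨by linarith, by linarith⟩
  have hr : r ∈ I := hsub ⟨by linarith, by linarith⟩
  -- monotonicity in the left variable
  have hleft : ∀ y ∈ Icc r s, g₁ y / (g y - g q) - 1 / (y - q) <
      g₁ y / (g y - g p) - 1 / (y - p) := by
    intro y hy
    have hyI : y ∈ I := hsub ⟨by linarith [hy.1], hy.2⟩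
    have hder : ∀ x ∈ Icc p q, HasDerivAt (fun x => g₁ y / (g y - g x) - 1 / (y - x))
        (g₁ x * g₁ y / (g y - g x) ^ 2 - 1 / (y - x) ^ 2) x := by
      intro x hx
      have hxI : x ∈ I := hsub ⟨hx.1, by linarith [hx.2]⟩
      have hxy : x < y := by linarith [hx.2, hy.1]
      have h1 : HasDerivAt (fun x => g₁ y / (g y - g x) - 1 / (y - x))
          ((0 * (g y - g x) - g₁ y * (-g₁ x)) / (g y - g x) ^ 2 -
            (0 * (y - x) - 1 * (-1)) / (y - x) ^ 2) x :=
        ((hasDerivAt_const x (g₁ y)).div ((hg x hxI).const_sub (g y))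
        (sub_pos.2 (hmono hxI hyI hxy)).ne').sub ((hasDerivAt_const x (1:ℝ)).div
        ((hasDerivAt_id x).const_sub y) (sub_pos.2 hxy).ne')
      exact h1.congr_deriv (by ring)
    have hanti : StrictAntiOn (fun x => g₁ y / (g y - g x) - 1 / (y - x)) (Icc p q) := by
      refine strictAntiOn_of_deriv_neg (convex_Icc p q)
        (fun x hx => (hder x hx).continuousAt.continuousWithinAt) fun x hx => ?_
      rw [interior_Icc] at hx
      have hx' := Ioo_subset_Icc_self hx
      have hxI : x ∈ I := hsub ⟨hx'.1, by linarith [hx'.2]⟩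
      have hxy : x < y := by linarith [hx'.2, hy.1]
      have h1 := sub_pos.2 (hmono hxI hyI hxy)
      have h2 := sub_pos.2 hxy
      rw [(hder x hx').deriv, sub_neg, div_lt_div_iff₀ (by positivity) (by positivity), one_mul]
      exact hker x hxI y hyI hxy
    exact hanti ⟨le_rfl, hpq.le⟩ ⟨hpq.le, le_rfl⟩ hpq
  -- monotonicity in the right variable
  set F : ℝ → ℝ := fun y => Real.log (g y - g p) - Real.log (g y - g q) -
    (Real.log (y - p) - Real.log (y - q)) with hF
  have hpos : ∀ y ∈ Icc r s, 0 < g y - g p ∧ 0 < g y - g q ∧ 0 < y - p ∧ 0 < y - q := by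
    intro y hy
    have hyI : y ∈ I := hsub ⟨by linarith [hy.1], hy.2⟩
    exact ⟨sub_pos.2 (hmono hp hyI (by linarith [hy.1])),
      sub_pos.2 (hmono hq hyI (by linarith [hy.1])), by linarith [hy.1], by linarith [hy.1]⟩
  have hFder : ∀ y ∈ Icc r s, HasDerivAt F (g₁ y / (g y - g p) - g₁ y / (g y - g q) -
      (1 / (y - p) - 1 / (y - q))) y := by
    intro y hy
    have hyI : y ∈ I := hsub ⟨by linarith [hy.1], hy.2⟩
    obtain ⟨h1, h2, h3, h4⟩ := hpos y hy
    exact ((((hg y hyI).sub_const _).log h1.ne').sub (((hg y hyI).sub_const _).log h2.ne')).sub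
      ((((hasDerivAt_id y).sub_const p).log h3.ne').sub
        (((hasDerivAt_id y).sub_const q).log h4.ne'))
  have hFmono : StrictMonoOn F (Icc r s) := by
    refine strictMonoOn_of_deriv_pos (convex_Icc r s)
      (fun y hy => (hFder y hy).continuousAt.continuousWithinAt) fun y hy => ?_
    rw [interior_Icc] at hy
    have hy' := Ioo_subset_Icc_self hy
    rw [(hFder y hy').deriv]
    linarith [hleft y hy']
  have hlt := hFmono ⟨le_rfl, hrs.le⟩ ⟨hrs.le, le_rfl⟩ hrs
  obtain ⟨a1, a2, a3, a4⟩ := hpos r ⟨le_rfl, hrs.le⟩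
  obtain ⟨b1, b2, b3, b4⟩ := hpos s ⟨hrs.le, le_rfl⟩
  rw [crossRatio_eq hpq hqr hrs, crossRatio_eq (hmono hp hq hpq) (hmono hq hr hqr)
    (hmono hr hs hrs)]
  refine sub_lt_sub_right ((Real.log_lt_log_iff (by positivity) (by positivity)).1 ?_) 1
  rw [Real.log_div (by positivity) (by positivity), Real.log_div (by positivity) (by positivity),
    Real.log_mul a1.ne' b2.ne', Real.log_mul a2.ne' b1.ne', Real.log_mul a3.ne' b4.ne',
    Real.log_mul a4.ne' b3.ne']
  simp only [hF] at hlt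
  linarith

/-- Negative Schwarzian derivative makes the inverse square root of the derivative strictly convex. -/
lemma strictConvexOn_inv_sqrt_deriv {g₁ g₂ g₃ : ℝ → ℝ} {α β : ℝ}
    (hg₁ : ∀ x ∈ Ioo α β, HasDerivAt g₁ (g₂ x) x) (hg₂ : ∀ x ∈ Ioo α β, HasDerivAt g₂ (g₃ x) x)
    (hpos : ∀ x ∈ Ioo α β, 0 < g₁ x)
    (hS : ∀ x ∈ Ioo α β, g₃ x / g₁ x - 3 / 2 * (g₂ x / g₁ x) ^ 2 < 0) :
    StrictConvexOn ℝ (Ioo α β) fun x => (√(g₁ x))⁻¹ := by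
  have hd : ∀ x ∈ Ioo α β, HasDerivAt (fun x => (√(g₁ x))⁻¹)
      (-(g₂ x / (2 * (g₁ x * √(g₁ x))))) x := by
    intro x hx
    have h0 := hpos x hx
    have hs := Real.sqrt_pos.2 h0
    refine (((hg₁ x hx).sqrt h0.ne').inv hs.ne').congr_deriv ?_
    rw [Real.sq_sqrt h0.le]
    field_simp
  have hd2 : ∀ x ∈ Ioo α β, HasDerivAt (fun x => -(g₂ x / (2 * (g₁ x * √(g₁ x)))))
      (-(1 / 2) * (√(g₁ x))⁻¹ * (g₃ x / g₁ x - 3 / 2 * (g₂ x / g₁ x) ^ 2)) x := by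
    intro x hx
    have h0 := hpos x hx
    have hs := Real.sqrt_pos.2 h0
    have h1 : HasDerivAt (fun x => -(g₂ x / (2 * (g₁ x * √(g₁ x)))))
        (-((g₃ x * (2 * (g₁ x * √(g₁ x))) - g₂ x * (2 * (g₂ x * √(g₁ x) +
          g₁ x * (g₂ x / (2 * √(g₁ x)))))) / (2 * (g₁ x * √(g₁ x))) ^ 2)) x :=
      ((hg₂ x hx).div (((hg₁ x hx).mul ((hg₁ x hx).sqrt h0.ne')).const_mul 2)
        (mul_pos two_pos (mul_pos h0 hs)).ne').neg
    refine h1.congr_deriv ?_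
    have h2 := Real.sq_sqrt h0.le
    generalize √(g₁ x) = σ at hs h2 ⊢
    rw [← h2]
    field_simp
    ring
  refine strictConvexOn_of_deriv2_pos' (convex_Ioo α β)
    (fun x hx => (hd x hx).continuousAt.continuousWithinAt) fun x hx => ?_
  have heq : deriv (fun x => (√(g₁ x))⁻¹) =ᶠ[nhds x] fun x => -(g₂ x / (2 * (g₁ x * √(g₁ x)))) :=
    Filter.eventuallyEq_of_mem (isOpen_Ioo.mem_nhds hx) fun y hy => (hd y hy).deriv
  rw [Function.iterate_succ_apply', Function.iterate_one, heq.deriv_eq, (hd2 x hx).deriv]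
  have hs := inv_pos.2 (Real.sqrt_pos.2 (hpos x hx))
  nlinarith [mul_pos hs (neg_pos.2 (hS x hx))]

/-- A bound on the nonlinearity controls the ratio of difference quotients. -/
lemma sub_mul_sub_le_of_lipschitz_log {g g₁ : ℝ → ℝ} {B : NNReal} {s t w : ℝ}
    (hc : ContinuousOn g (Icc s w)) (hg : ∀ x ∈ Ioo s w, HasDerivAt g (g₁ x) x)
    (hpos : ∀ x ∈ Ioo s w, 0 < g₁ x)
    (hlip : LipschitzOnWith B (fun x => Real.log (g₁ x)) (Icc s w))
    (hst : s < t) (htw : t ≤ w) :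
    (g w - g t) * (t - s) ≤ Real.exp (B * (w - s)) * ((g t - g s) * (w - t)) := by
  rcases htw.eq_or_lt with rfl | htw
  · simp
  obtain ⟨ξ, hξ, hξ'⟩ := exists_hasDerivAt_eq_slope g g₁ htw
    (hc.mono (Icc_subset_Icc hst.le le_rfl)) fun x hx => hg x ⟨hst.trans hx.1, hx.2⟩
  obtain ⟨η, hη, hη'⟩ := exists_hasDerivAt_eq_slope g g₁ hst
    (hc.mono (Icc_subset_Icc le_rfl htw.le)) fun x hx => hg x ⟨hx.1, hx.2.trans htw⟩
  rw [eq_div_iff (by linarith)] at hξ' hη'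
  have mξ : ξ ∈ Ioo s w := ⟨hst.trans hξ.1, hξ.2⟩
  have mη : η ∈ Ioo s w := ⟨hη.1, hη.2.trans htw⟩
  have h1 := hlip.dist_le_mul ξ (Ioo_subset_Icc_self mξ) η (Ioo_subset_Icc_self mη)
  rw [Real.dist_eq, Real.dist_eq, abs_of_pos (show 0 < ξ - η by linarith [hξ.1, hη.2])] at h1
  have h2 : Real.log (g₁ ξ) ≤ B * (w - s) + Real.log (g₁ η) := by
    have h3 : (B:ℝ) * (ξ - η) ≤ B * (w - s) :=
      mul_le_mul_of_nonneg_left (by linarith [mξ.2, mη.1]) B.2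
    linarith [le_abs_self (Real.log (g₁ ξ) - Real.log (g₁ η))]
  have h3 : g₁ ξ ≤ Real.exp (B * (w - s)) * g₁ η := by
    rw [← Real.exp_log (hpos ξ mξ), ← Real.exp_log (hpos η mη), ← Real.exp_add]
    exact Real.exp_le_exp.2 h2
  rw [← hξ', ← hη']
  have h4 : 0 ≤ (w - t) * (t - s) := mul_nonneg (by linarith) (by linarith)
  calc g₁ ξ * (w - t) * (t - s) = g₁ ξ * ((w - t) * (t - s)) := by ring
    _ ≤ Real.exp (B * (w - s)) * g₁ η * ((w - t) * (t - s)) := mul_le_mul_of_nonneg_right h3 h4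
    _ = _ := by ring

/-- A map of `[0, 1]` with negative Schwarzian derivative and positive derivative off `c` is
`LorenzLike`. -/
lemma LorenzLike.of_negSchwarzian {f : ℝ → ℝ} {c : ℝ} (hc : c ∈ Ioo (0:ℝ) 1)
    (hmaps : MapsTo f (Icc 0 1) (Icc 0 1)) (hone : f 1 = 1) (hS : NegSchwarzian f c)
    (hpos : ∀ x ∈ Icc (0:ℝ) 1 \ {c}, 0 < derivWithin f (Icc 0 1 \ {c}) x) :
    LorenzLike f c := by
  obtain ⟨hsmooth, hneg⟩ := hS
  set S : Set ℝ := Icc 0 1 \ {c} with hSdef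
  have hUD : UniqueDiffOn ℝ S := (uniqueDiffOn_Icc zero_lt_one).inter isOpen_compl_singleton
  have hsm₁ : ContDiffOn ℝ 2 (derivWithin f S) S := hsmooth.derivWithin hUD (by norm_num)
  have hsm₂ : ContDiffOn ℝ 1 (derivWithin (derivWithin f S) S) S :=
    hsm₁.derivWithin hUD (by norm_num)
  have hnhds : ∀ x ∈ Ioo (0:ℝ) 1, x ≠ c → S ∈ nhds x := fun x hx hxc =>
    Filter.inter_mem (Icc_mem_nhds hx.1 hx.2) (isOpen_compl_singleton.mem_nhds hxc)
  have hder : ∀ {g : ℝ → ℝ} {n : WithTop ℕ∞}, ContDiffOn ℝ n g S → n ≠ 0 → ∀ x ∈ Ioo (0:ℝ) 1,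
      x ≠ c → HasDerivAt g (derivWithin g S x) x := fun hg hn x hx hxc =>
    ((hg.differentiableOn hn x (mem_of_mem_nhds (hnhds x hx hxc))).hasDerivWithinAt).hasDerivAt
      (hnhds x hx hxc)
  have hleft : ∀ x ∈ Ioo 0 c, x ∈ Ioo (0:ℝ) 1 ∧ x ≠ c := fun x hx =>
    ⟨⟨hx.1, hx.2.trans hc.2⟩, hx.2.ne⟩
  have hright : ∀ x ∈ Ioo c 1, x ∈ Ioo (0:ℝ) 1 ∧ x ≠ c := fun x hx =>
    ⟨⟨hc.1.trans hx.1, hx.2⟩, hx.1.ne'⟩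
  have hmem : ∀ x ∈ Ioo (0:ℝ) 1, x ≠ c → x ∈ S := fun x hx hxc => mem_of_mem_nhds (hnhds x hx hxc)
  have hmonoL : StrictMonoOn f (Ico 0 c) := by
    refine strictMonoOn_of_deriv_pos (convex_Ico 0 c)
      (hsmooth.continuousOn.mono fun x hx => ⟨⟨hx.1, hx.2.le.trans hc.2.le⟩, hx.2.ne⟩)
      fun x hx => ?_
    rw [interior_Ico] at hx
    obtain ⟨h1, h2⟩ := hleft x hx
    rw [(hder hsmooth (by norm_num) x h1 h2).deriv]
    exact hpos x (hmem x h1 h2)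
  have hmonoR : StrictMonoOn f (Ioc c 1) := by
    refine strictMonoOn_of_deriv_pos (convex_Ioc c 1)
      (hsmooth.continuousOn.mono fun x hx => ⟨⟨hc.1.le.trans hx.1.le, hx.2⟩, hx.1.ne'⟩)
      fun x hx => ?_
    rw [interior_Ioc] at hx
    obtain ⟨h1, h2⟩ := hright x hx
    rw [(hder hsmooth (by norm_num) x h1 h2).deriv]
    exact hpos x (hmem x h1 h2)
  have hcross : ∀ α β, (∀ x ∈ Ioo α β, x ∈ Ioo (0:ℝ) 1 ∧ x ≠ c) → StrictMonoOn f (Ioo α β) →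
      ∀ p q r s, α < p → p < q → q < r → r < s → s < β →
      crossRatio (f p) (f q) (f r) (f s) < crossRatio p q r s := by
    intro α β hαβ hm p q r s h1 h2 h3 h4 h5
    have hd : ∀ x ∈ Ioo α β, HasDerivAt f (derivWithin f S x) x := fun x hx =>
      hder hsmooth (by norm_num) x (hαβ x hx).1 (hαβ x hx).2
    have hp : ∀ x ∈ Ioo α β, 0 < derivWithin f S x := fun x hx =>
      hpos x (hmem x (hαβ x hx).1 (hαβ x hx).2)
    have hconv := strictConvexOn_inv_sqrt_deriv
      (fun x hx => hder hsm₁ (by norm_num) x (hαβ x hx).1 (hαβ x hx).2)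
      (fun x hx => hder hsm₂ (by norm_num) x (hαβ x hx).1 (hαβ x hx).2) hp
      (fun x hx => hneg x (hmem x (hαβ x hx).1 (hαβ x hx).2))
    exact crossRatio_lt_of_mul_deriv_lt ordConnected_Ioo hd hm
      (fun x hx y hy => mul_deriv_lt_of_strictConvexOn ordConnected_Ioo hd hp hconv hx hy)
      ⟨h1, by linarith⟩ ⟨by linarith, h5⟩ h2 h3 h4
  have hdist : ∀ α β, Icc α β ⊆ S → ∃ B : ℝ, ∀ s t w, α ≤ s → s < t → t ≤ w → w ≤ β →
      (f w - f t) * (t - s) ≤ Real.exp (B * (w - s)) * ((f t - f s) * (w - t)) := by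
    intro α β hαβ
    have hlog : ContDiffOn ℝ 1 (fun x => Real.log (derivWithin f S x)) (Icc α β) :=
      ((hsm₁.of_le (by norm_num)).mono hαβ).log fun x hx => (hpos x (hαβ hx)).ne'
    obtain ⟨B, hB⟩ := hlog.exists_lipschitzOnWith (by norm_num) (convex_Icc α β) isCompact_Icc
    refine ⟨B, fun s t w h1 h2 h3 h4 => ?_⟩
    have hsub : Icc s w ⊆ Icc α β := Icc_subset_Icc h1 h4
    refine sub_mul_sub_le_of_lipschitz_log (g₁ := derivWithin f S)
      (hsmooth.continuousOn.mono (hsub.trans hαβ)) (fun x hx => ?_)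
      (fun x hx => hpos x (hαβ (hsub (Ioo_subset_Icc_self hx)))) (hB.mono hsub) h2 h3
    have hs := (hαβ (hsub ⟨le_rfl, h2.le.trans h3⟩)).1
    have hw := (hαβ (hsub ⟨h2.le.trans h3, le_rfl⟩)).1
    exact hder hsmooth (by norm_num) x ⟨hs.1.trans_lt hx.1, hx.2.trans_le hw.2⟩
      (hαβ (hsub (Ioo_subset_Icc_self hx))).2
  refine ⟨hc, hmaps, hone, hmonoL, hmonoR, hsmooth.continuousOn, ?_, ?_⟩
  · rintro p q r s h1 h2 h3 h4 h5 (h6 | h6)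
    · exact hcross 0 c hleft (hmonoL.mono Ioo_subset_Ico_self) p q r s h1 h2 h3 h4 h6
    · exact hcross c 1 hright (hmonoR.mono Ioo_subset_Ioc_self) p q r s h6 h2 h3 h4 h5
  · intro e he
    obtain ⟨B₁, hB₁⟩ := hdist 0 (c - e) fun x hx =>
      ⟨⟨hx.1, by linarith [hx.2, hc.2]⟩, (show x < c by linarith [hx.2]).ne⟩
    obtain ⟨B₂, hB₂⟩ := hdist (c + e) 1 fun x hx =>
      ⟨⟨by linarith [hx.1, hc.1], hx.2⟩, (show c < x by linarith [hx.1]).ne'⟩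
    have hmonoS : ∀ s t, 0 ≤ s → s ≤ t → t ≤ 1 → (t < c ∨ c < s) → f s ≤ f t := by
      rintro s t h1 h2 h3 (h4 | h4)
      · exact hmonoL.monotoneOn ⟨h1, h2.trans_lt h4⟩ ⟨h1.trans h2, h4⟩ h2
      · exact hmonoR.monotoneOn ⟨h4, h2.trans h3⟩ ⟨h4.trans_le h2, h3⟩ h2
    refine ⟨max 0 (max B₁ B₂), le_max_left _ _, fun s t w h1 h2 h3 h4 h5 => ?_⟩
    have key : ∀ B ≤ max 0 (max B₁ B₂), Real.exp (B * (w - s)) * ((f t - f s) * (w - t)) ≤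
        Real.exp (max 0 (max B₁ B₂) * (w - s)) * ((f t - f s) * (w - t)) := by
      intro B hB
      have h6 : f s ≤ f t := hmonoS s t h1 h2.le (h3.trans h4)
        (h5.imp (fun h => by linarith) (fun h => by linarith))
      refine mul_le_mul_of_nonneg_right (Real.exp_le_exp.2
        (mul_le_mul_of_nonneg_right hB (by linarith))) (mul_nonneg (by linarith) (by linarith))
    rcases h5 with h5 | h5
    · exact (hB₁ s t w h1 h2 h3 h5).trans
        (key B₁ ((le_max_left _ _).trans (le_max_right _ _)))
    · exact (hB₂ s t w h5 h2 h3 h4).trans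
        (key B₂ ((le_max_right _ _).trans (le_max_right _ _)))

lemma derivWithin_comp_pos {g Q f : ℝ → ℝ} {S s : Set ℝ} {x q : ℝ} (hS : UniqueDiffOn ℝ S)
    (hg : DifferentiableOn ℝ g (Icc 0 1)) (hg' : ∀ y ∈ Icc (0:ℝ) 1, 0 < derivWithin g (Icc 0 1) y)
    (hQ : HasDerivAt Q q x) (hq : 0 < q) (hmaps : MapsTo Q (S ∩ s) (Icc 0 1))
    (heq : EqOn f (g ∘ Q) (S ∩ s)) (hx : x ∈ S) (hs : s ∈ nhds x) : 0 < derivWithin f S x := by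
  have hxs : x ∈ S ∩ s := ⟨hx, mem_of_mem_nhds hs⟩
  have h1 : HasDerivWithinAt f (derivWithin g (Icc 0 1) (Q x) * q) (S ∩ s) x :=
    ((hg (Q x) (hmaps hxs)).hasDerivWithinAt.comp x hQ.hasDerivWithinAt hmaps).congr heq (heq hxs)
  rw [hasDerivWithinAt_inter hs] at h1
  rw [h1.derivWithin (hS x hx)]
  exact mul_pos (hg' _ (hmaps hxs)) hq

lemma mapsTo_of_derivWithin_pos {g : ℝ → ℝ} (hg : DifferentiableOn ℝ g (Icc 0 1))
    (hg' : ∀ y ∈ Icc (0:ℝ) 1, 0 < derivWithin g (Icc 0 1) y) (h0 : g 0 = 0) (h1 : g 1 = 1) :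
    MapsTo g (Icc 0 1) (Icc 0 1) := by
  have hm : MonotoneOn g (Icc 0 1) := by
    refine (strictMonoOn_of_deriv_pos (convex_Icc 0 1) hg.continuousOn fun x hx => ?_).monotoneOn
    rw [interior_Icc] at hx
    rw [← derivWithin_of_mem_nhds (Icc_mem_nhds hx.1 hx.2)]
    exact hg' x (Ioo_subset_Icc_self hx)
  intro x hx
  rw [← h0, ← h1]
  exact ⟨h0.trans_le (h0.symm.trans_le (hm ⟨le_rfl, zero_le_one⟩ hx hx.1)),
    hm hx ⟨zero_le_one, le_rfl⟩ hx.2⟩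

lemma IsLorenz.lorenzLike {ρ u v c : ℝ} {φ ψ : ℝ → ℝ} (hL : IsLorenz 3 ρ u v c φ ψ)
    (hS : NegSchwarzian (lorenzF ρ u v c φ ψ) c) : LorenzLike (lorenzF ρ u v c φ ψ) c := by
  obtain ⟨hρ, hu0, hu1, hv0, hv1, hc0, hc1, hφ, hψ, hφ0, hφ1, hψ0, hψ1, hφ', hψ'⟩ := hL
  have hρ0 : 0 < ρ := by linarith
  have hc1' : 0 < 1 - c := by linarith
  replace hφ := hφ.differentiableOn (by norm_num)
  replace hψ := hψ.differentiableOn (by norm_num)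
  have hleft : ∀ x, 0 ≤ x → x < c → u * (1 - ((c - x) / c) ^ ρ) ∈ Icc (0:ℝ) 1 := by
    intro x hx hxc
    have h0 : 0 ≤ (c - x) / c := div_nonneg (by linarith) hc0.le
    have h1 : (c - x) / c ≤ 1 := by rw [div_le_one hc0]; linarith
    have h2 := Real.rpow_nonneg h0 ρ
    have h3 := Real.rpow_le_one h0 h1 hρ0.le
    exact ⟨mul_nonneg hu0.le (by linarith), mul_le_one₀ hu1 (by linarith) (by linarith)⟩
  have hright : ∀ x, c ≤ x → x ≤ 1 → 1 + v * (-1 + ((x - c) / (1 - c)) ^ ρ) ∈ Icc (0:ℝ) 1 := by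
    intro x hxc hx
    have h0 : 0 ≤ (x - c) / (1 - c) := div_nonneg (by linarith) hc1'.le
    have h1 : (x - c) / (1 - c) ≤ 1 := by rw [div_le_one hc1']; linarith
    have h2 := Real.rpow_nonneg h0 ρ
    have h3 := Real.rpow_le_one h0 h1 hρ0.le
    exact ⟨by nlinarith, by nlinarith⟩
  have hone : lorenzF ρ u v c φ ψ 1 = 1 := by
    rw [lorenzF, if_neg hc1.le.not_gt, div_self hc1'.ne', Real.one_rpow]
    simpa using hψ1
  refine LorenzLike.of_negSchwarzian ⟨hc0, hc1⟩ (fun x hx => ?_) hone hS fun x hx => ?_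
  · rcases lt_or_ge x c with hxc | hxc
    · rw [lorenzF, if_pos hxc]
      exact mapsTo_of_derivWithin_pos hφ hφ' hφ0 hφ1 (hleft x hx.1 hxc)
    · rw [lorenzF, if_neg hxc.not_gt]
      exact mapsTo_of_derivWithin_pos hψ hψ' hψ0 hψ1 (hright x hxc hx.2)
  · have hUD : UniqueDiffOn ℝ (Icc (0:ℝ) 1 \ {c}) :=
      (uniqueDiffOn_Icc zero_lt_one).inter isOpen_compl_singleton
    rcases lt_or_gt_of_ne hx.2 with hxc | hxc
    · have hbase : 0 < (c - x) / c := div_pos (sub_pos.2 hxc) hc0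
      have hQ : HasDerivAt (fun x => u * (1 - ((c - x) / c) ^ ρ))
          (u * -(-1 / c * ρ * ((c - x) / c) ^ (ρ - 1))) x :=
        (((((hasDerivAt_id x).const_sub c).div_const c).rpow_const
          (Or.inl hbase.ne')).const_sub 1).const_mul u
      refine derivWithin_comp_pos hUD hφ hφ' hQ ?_ (s := Iio c) (fun y hy => hleft y hy.1.1.1 hy.2)
        (fun y hy => if_pos hy.2) hx (Iio_mem_nhds hxc)
      have h1 := Real.rpow_pos_of_pos hbase (ρ - 1)
      rw [show u * -(-1 / c * ρ * ((c - x) / c) ^ (ρ - 1)) =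
        u * (1 / c * ρ * ((c - x) / c) ^ (ρ - 1)) by ring]
      positivity
    · have hbase : 0 < (x - c) / (1 - c) := div_pos (sub_pos.2 hxc) hc1'
      have hQ : HasDerivAt (fun x => 1 + v * (-1 + ((x - c) / (1 - c)) ^ ρ))
          (v * (1 / (1 - c) * ρ * ((x - c) / (1 - c)) ^ (ρ - 1))) x :=
        ((((((hasDerivAt_id x).sub_const c).div_const (1 - c)).rpow_const
          (Or.inl hbase.ne')).const_add (-1)).const_mul v).const_add 1
      refine derivWithin_comp_pos hUD hψ hψ' hQ ?_ (s := Ioi c)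
        (fun y hy => hright y (le_of_lt hy.2) hy.1.1.2)
        (fun y hy => if_neg (lt_asymm hy.2)) hx (Ioi_mem_nhds hxc)
      have h1 := Real.rpow_pos_of_pos hbase (ρ - 1)
      positivity

/-- For a C³ Lorenz map with negative Schwarzian and no periodic attractors, and a
nice interval `C = (a,b) ∋ c`, the complement of the domain of the transfer map to
`C` has zero Lebesgue measure; equivalently, Lebesgue-almost every point of `[0,1]`
eventually enters `C` under iteration of `f`. -/
theorem transfer_complement_measure_zero (ρ u v c : ℝ) (φ ψ : ℝ → ℝ)
    (hL : IsLorenz 3 ρ u v c φ ψ)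
    (hS : NegSchwarzian (lorenzF ρ u v c φ ψ) c)
    (hNPA : NoPeriodicAttractor (lorenzF ρ u v c φ ψ))
    (a b : ℝ) (ha : 0 ≤ a) (hac : a < c) (hcb : c < b) (hb : b ≤ 1)
    (hnice : ∀ k : ℕ, 1 ≤ k →
      (lorenzF ρ u v c φ ψ)^[k] a ∉ Ioo a b ∧
      (lorenzF ρ u v c φ ψ)^[k] b ∉ Ioo a b) :
    MeasureTheory.volume (avoidSet (lorenzF ρ u v c φ ψ) a b) = 0 ∧
    ∀ᵐ x ∂(MeasureTheory.volume.restrict (Icc (0:ℝ) 1)),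
      ∃ n : ℕ, (lorenzF ρ u v c φ ψ)^[n] x ∈ Ioo a b := by
  have h0 := (hL.lorenzLike hS).volume_avoidSet hNPA hac hcb hb
  refine ⟨h0, (MeasureTheory.ae_restrict_iff' measurableSet_Icc).2
    (MeasureTheory.measure_mono_null (fun x hx => ?_) h0)⟩
  by_contra hxA
  refine hx fun hxI => ?_
  by_contra hne
  exact hxA ⟨hxI, not_exists.1 hne⟩
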